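/- Let h = 2n+1 be an odd integer with n ≥ 1, let 0 ≤ i ≤ n, and let λ be an h-strict partition with h-bar-core σ and h-bar-weight w. Then ψ_i(λ) has h-bar-core ψ_i(σ) and h-bar-weight w. -/

import Mathlib

/-- A partition: a weakly decreasing sequence of non-negative integers with
finite sum (finitely many nonzero parts), indexed from 0 (so `parts 0` is λ₁). -/
structure BPartition where
  parts : ℕ →₀ ℕ
  antitone : ∀ r, parts (r + 1) ≤ parts r

namespace BPartition

/-- The multiset of positive parts of a partition. -/
def partsM (lam : BPartition) : Multiset ℕ :=
  lam.parts.support.val.map (fun r => lam.parts r)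

/-- The Young diagram: nodes `(r, c)` with rows indexed from 0 and columns from 1. -/
def diagram (lam : BPartition) : Set (ℕ × ℕ) :=
  {x | 1 ≤ x.2 ∧ x.2 ≤ lam.parts x.1}

/-- A partition is strict if λ_r > λ_{r+1} whenever λ_r > 0. -/
def IsStrict (lam : BPartition) : Prop :=
  ∀ r, 0 < lam.parts r → lam.parts (r + 1) < lam.parts r

/-- A partition is h-strict if each part is either strictly bigger than the next,
or positive and divisible by h, or zero. -/
def IsHStrict (h : ℕ) (lam : BPartition) : Prop :=
  ∀ r, lam.parts (r + 1) < lam.parts r ∨ (0 < lam.parts r ∧ h ∣ lam.parts r) ∨ lam.parts r = 0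

/-- An h-strict partition is restricted if for every r either λ_{r+1} > λ_r − h,
or λ_{r+1} = λ_r − h and h does not divide λ_r. -/
def IsRestricted (h : ℕ) (lam : BPartition) : Prop :=
  ∀ r, lam.parts r < lam.parts (r + 1) + h ∨
    (lam.parts (r + 1) + h = lam.parts r ∧ ¬ h ∣ lam.parts r)

/-- The residue of a node in column c (1-indexed): the smaller of the residues of
c − 1 and of −c modulo h. -/
def colRes (h c : ℕ) : ℕ := min ((c - 1) % h) ((h - c % h) % h)

/-- `x` is an addable i-node of `lam`. -/
def Addable (h i : ℕ) (lam : BPartition) (x : ℕ × ℕ) : Prop :=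
  colRes h x.2 = i ∧ x ∉ diagram lam ∧
  ∃ nu : BPartition, IsHStrict h nu ∧ diagram lam ⊆ diagram nu ∧ x ∈ diagram nu ∧
    ∀ y ∈ diagram nu, y ∉ diagram lam → colRes h y.2 = i

/-- `x` is a removable i-node of `lam`. -/
def Removable (h i : ℕ) (lam : BPartition) (x : ℕ × ℕ) : Prop :=
  x ∈ diagram lam ∧
  ∃ mu : BPartition, IsHStrict h mu ∧ diagram mu ⊆ diagram lam ∧ x ∉ diagram mu ∧
    ∀ y ∈ diagram lam, y ∉ diagram mu → colRes h y.2 = i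

/-- Removal of a single h-bar from `lam` giving `mu`, recording the value `v`:
either a part `v ≥ h` is replaced by `v − h` (deleted if `v = h`), or two parts
summing to `h` are deleted, in which case `v` is the larger of the two. -/
def barStepRec (h : ℕ) (lam mu : BPartition) (v : ℕ) : Prop :=
  IsHStrict h mu ∧
  ((v = h ∧ v ∈ partsM lam ∧ partsM mu = (partsM lam).erase v) ∨
   (h < v ∧ v ∈ partsM lam ∧ partsM mu = (v - h) ::ₘ (partsM lam).erase v) ∨
   (∃ a b : ℕ, a + b = h ∧ a ∈ partsM lam ∧ b ∈ (partsM lam).erase a ∧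
      v = max a b ∧ partsM mu = ((partsM lam).erase a).erase b))

/-- Removal of a single h-bar. -/
def barStep (h : ℕ) (lam mu : BPartition) : Prop :=
  ∃ v, barStepRec h lam mu v

/-- An h-bar-core: an h-strict partition from which no h-bar can be removed. -/
def IsBarCore (h : ℕ) (lam : BPartition) : Prop :=
  IsHStrict h lam ∧ ∀ mu, ¬ barStep h lam mu

/-- A chain of `w` h-bar removals from `lam` down to `mu`. -/
def barChain (h : ℕ) : ℕ → BPartition → BPartition → Prop
  | 0, lam, mu => lam = mu
  | w + 1, lam, mu => ∃ nu, barStep h lam nu ∧ barChain h w nu mu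

/-- `lam ∈ P_{τ,w}`: `lam` is h-strict with h-bar-core `tau` and h-bar-weight `w`. -/
def InBlock (h : ℕ) (tau : BPartition) (w : ℕ) (lam : BPartition) : Prop :=
  IsHStrict h lam ∧ IsBarCore h tau ∧ barChain h w lam tau

/-- The left-to-right order on node positions along the edge of a Young diagram:
smaller column first; within a column, larger row first. -/
def posLE (x y : ℕ × ℕ) : Prop := x.2 < y.2 ∨ (x.2 = y.2 ∧ y.1 ≤ x.1)

/-- `x` is a normal i-node: a removable i-node surviving (as a − sign) in the
reduced i-signature; equivalently, every window of the i-signature ending at `x`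
contains strictly more removable than addable i-nodes. -/
def Normal (h i : ℕ) (lam : BPartition) (x : ℕ × ℕ) : Prop :=
  Removable h i lam x ∧ ∀ z : ℕ × ℕ, posLE z x →
    Set.ncard {y | Addable h i lam y ∧ posLE z y ∧ posLE y x} <
      Set.ncard {y | Removable h i lam y ∧ posLE z y ∧ posLE y x}

/-- `x` is a conormal i-node: an addable i-node surviving (as a + sign) in the
reduced i-signature. -/
def Conormal (h i : ℕ) (lam : BPartition) (x : ℕ × ℕ) : Prop :=
  Addable h i lam x ∧ ∀ z : ℕ × ℕ, posLE x z →
    Set.ncard {y | Removable h i lam y ∧ posLE x y ∧ posLE y z} <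
      Set.ncard {y | Addable h i lam y ∧ posLE x y ∧ posLE y z}

/-- The node set of ψ_i(λ): add the leftmost s − r conormal i-nodes if s ≥ r,
remove the rightmost r − s normal i-nodes if r > s, where r = #normal and
s = #conormal i-nodes. -/
noncomputable def psiSet (h i : ℕ) (lam : BPartition) : Set (ℕ × ℕ) :=
  if Set.ncard {x | Normal h i lam x} ≤ Set.ncard {x | Conormal h i lam x} then
    diagram lam ∪ {x | Conormal h i lam x ∧
      Set.ncard {y | Conormal h i lam y ∧ posLE y x} ≤
        Set.ncard {x | Conormal h i lam x} - Set.ncard {x | Normal h i lam x}}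
  else
    diagram lam \ {x | Normal h i lam x ∧
      Set.ncard {y | Normal h i lam y ∧ posLE x y} ≤
        Set.ncard {x | Normal h i lam x} - Set.ncard {x | Conormal h i lam x}}

open Classical in
/-- The involution ψ_i. -/
noncomputable def psi (h i : ℕ) (lam : BPartition) : BPartition :=
  if hex : ∃ mu : BPartition, diagram mu = psiSet h i lam then hex.choose else lam

/-- The set of occupied positions of the abacus display of a strict partition. -/
def abacus (lam : BPartition) : Set ℤ :=
  {a | a = 0 ∨ (0 < a ∧ a.toNat ∈ partsM lam) ∨ (a < 0 ∧ (-a).toNat ∉ partsM lam)}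

/-- The dominance order: λ ⊴ μ. -/
def domLE (lam mu : BPartition) : Prop :=
  ∀ r, ∑ s ∈ Finset.range r, lam.parts s ≤ ∑ s ∈ Finset.range r, mu.parts s

/-- Strict dominance: λ ◁ μ. -/
def domLT (lam mu : BPartition) : Prop := domLE lam mu ∧ lam ≠ mu

/-- Lexicographic order: λ <lex μ. -/
def lexLT (lam mu : BPartition) : Prop :=
  ∃ r, lam.parts r < mu.parts r ∧ ∀ s < r, lam.parts s = mu.parts s

/-- Colexicographic order: λ <colex μ. -/
def colexLT (lam mu : BPartition) : Prop :=
  ∃ r, mu.parts r < lam.parts r ∧ ∀ s, r < s → lam.parts s = mu.parts s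

/-- λ ↔ᵢ μ: every node of the symmetric difference of the diagrams has residue i. -/
def Link (h i : ℕ) (lam mu : BPartition) : Prop :=
  ∀ x : ℕ × ℕ, x ∈ (diagram lam \ diagram mu) ∪ (diagram mu \ diagram lam) →
    colRes h x.2 = i

/-- `a ≤ b` are the bar positions of `lam ∈ P_{τ,2}`: the values recorded by
some two-step removal of h-bars from `lam` down to `tau`. -/
def BarPositions (h : ℕ) (tau lam : BPartition) (a b : ℕ) : Prop :=
  a ≤ b ∧ ∃ (nu : BPartition) (v₁ v₂ : ℕ), barStepRec h lam nu v₁ ∧ barStepRec h nu tau v₂ ∧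
    ({a, b} : Multiset ℕ) = {v₁, v₂}

/-- The leg length of the bar of `lam ∈ P_{τ,2}` at bar position `c`. -/
noncomputable def legLen (h : ℕ) (tau lam : BPartition) (c : ℕ) : ℕ :=
  if h ≤ c then Set.ncard {x : ℕ | c - h < x ∧ x < c ∧ x ∈ partsM lam ∧ x ∈ partsM tau}
  else (h - c) + Set.ncard {x : ℕ | h - c < x ∧ x < c ∧ x ∈ partsM lam ∧ x ∈ partsM tau}

/-- ∂λ: the absolute difference of the two leg lengths of `lam`, whose bar
positions are `a ≤ b`. -/
noncomputable def ddd (h : ℕ) (tau lam : BPartition) (a b : ℕ) : ℕ :=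
  max (legLen h tau lam a) (legLen h tau lam b) - min (legLen h tau lam a) (legLen h tau lam b)

inductive Colour | black | white | grey
deriving DecidableEq

/-- β(τ): the number of parts of τ less than h. -/
def betaCount (h : ℕ) (tau : BPartition) : ℕ :=
  Multiset.card ((partsM tau).filter (fun x => x < h))

/-- The leg length of a 2h-bar of `lam` with larger bar position `b`. -/
noncomputable def legLen2 (h : ℕ) (tau lam : BPartition) (b : ℕ) : ℕ :=
  if 2 * h ≤ b then Set.ncard {x : ℕ | b - 2 * h < x ∧ x < b ∧ x ∈ partsM lam ∧ x ∈ partsM tau}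
  else (2 * h - b) + Set.ncard {x : ℕ | 2 * h - b < x ∧ x < b ∧ x ∈ partsM lam ∧ x ∈ partsM tau}

/-- The colour of `lam ∈ P_{τ,2}` with bar positions `a ≤ b`. -/
noncomputable def colour (h : ℕ) (tau lam : BPartition) (a b : ℕ) : Colour :=
  if 2 ≤ ddd h tau lam a b then Colour.grey
  else if ddd h tau lam a b = 1 then
    if h < b then Colour.grey
    else if (min (legLen h tau lam a) (legLen h tau lam b) + betaCount h tau) % 2 = 1 then
      Colour.black else Colour.white
  else
    if b = a + h ∨ a + b = 2 * h then
      if (legLen2 h tau lam b + 2 * betaCount h tau) % 4 = 0 ∨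
         (legLen2 h tau lam b + 2 * betaCount h tau) % 4 = 3 then Colour.black
      else Colour.white
    else
      if (legLen h tau lam a + betaCount h tau) % 2 = 1 then Colour.black else Colour.white

end BPartition

namespace BPartition

def okP (h v u : ℕ) : Prop := v < u ∨ (v = u ∧ u % h = 0)

lemma hstrict_iff (h : ℕ) (lam : BPartition) :
    IsHStrict h lam ↔ ∀ r, okP h (lam.parts (r + 1)) (lam.parts r) := by
  unfold IsHStrict okP
  refine forall_congr' fun r => ?_
  have := lam.antitone r
  rw [Nat.dvd_iff_mod_eq_zero]
  constructor
  · rintro (h1 | ⟨h1, h2⟩ | h1)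
    · exact Or.inl h1
    · rcases lt_or_eq_of_le this with h3 | h3
      · exact Or.inl h3
      · exact Or.inr ⟨h3, h2⟩
    · right
      refine ⟨by omega, by rw [h1]; simp⟩
  · rintro (h1 | ⟨h1, h2⟩)
    · exact Or.inl h1
    · rcases Nat.eq_zero_or_pos (lam.parts r) with h3 | h3
      · exact Or.inr (Or.inr h3)
      · exact Or.inr (Or.inl ⟨h3, h2⟩)

lemma anti (lam : BPartition) {r s : ℕ} (hrs : r ≤ s) : lam.parts s ≤ lam.parts r :=
  antitone_nat_of_succ_le (f := fun r => lam.parts r) lam.antitone hrs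

lemma exists_bound (lam : BPartition) : ∃ R, ∀ r, R ≤ r → lam.parts r = 0 := by
  refine ⟨lam.parts.support.sup id + 1, fun r hr => ?_⟩
  by_contra hne
  have : r ∈ lam.parts.support := Finsupp.mem_support_iff.2 hne
  have := Finset.le_sup (f := id) this
  simp at this
  omega

lemma mkP (h : ℕ) (f : ℕ → ℕ) (R : ℕ) (hR : ∀ r, R ≤ r → f r = 0)
    (hf : ∀ r, okP h (f (r + 1)) (f r)) :
    ∃ mu : BPartition, (∀ r, mu.parts r = f r) ∧ IsHStrict h mu := by
  have hfin : (Function.support f).Finite := by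
    refine (Set.finite_lt_nat R).subset fun r hr => ?_
    by_contra hlt
    exact hr (hR r (by simpa using hlt))
  refine ⟨⟨Finsupp.ofSupportFinite f hfin, fun r => ?_⟩, fun r => rfl, ?_⟩
  · rcases hf r with h1 | h1
    · exact h1.le
    · exact h1.1.le
  · rw [hstrict_iff]
    exact hf

lemma ext_parts {lam mu : BPartition} (H : ∀ r, lam.parts r = mu.parts r) : lam = mu := by
  cases lam; cases mu
  congr
  exact Finsupp.ext H

lemma mem_diagram (lam : BPartition) (r c : ℕ) :
    (r, c) ∈ diagram lam ↔ 1 ≤ c ∧ c ≤ lam.parts r := Iff.rfl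

lemma diagram_subset {lam mu : BPartition} :
    diagram lam ⊆ diagram mu ↔ ∀ r, lam.parts r ≤ mu.parts r := by
  constructor
  · intro H r
    rcases Nat.eq_zero_or_pos (lam.parts r) with h0 | h0
    · omega
    · exact (H (show (r, lam.parts r) ∈ diagram lam from ⟨h0, le_rfl⟩)).2
  · rintro H ⟨r, c⟩ ⟨h1, h2⟩
    exact ⟨h1, h2.trans (H r)⟩

lemma diagram_inj {lam mu : BPartition} (H : diagram lam = diagram mu) : lam = mu :=
  ext_parts fun r => le_antisymm (diagram_subset.1 H.subset r) (diagram_subset.1 H.symm.subset r)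

lemma mod_succ (h c : ℕ) (hh : 1 ≤ h) :
    ((c + 1) % h = 0 ∧ c % h + 1 = h) ∨ ((c + 1) % h = c % h + 1 ∧ c % h + 1 < h) := by
  have h1 := Nat.mod_lt c hh
  rcases Nat.lt_or_ge (c % h + 1) h with h2 | h2
  · right
    refine ⟨?_, h2⟩
    rw [Nat.add_mod, Nat.mod_eq_of_lt (show 1 < h by omega), Nat.mod_eq_of_lt h2]
  · left
    refine ⟨?_, by omega⟩
    have h3 : c % h + 1 = h := by omega
    have := Nat.mod_add_div c h
    have h4 : c + 1 = h * (c / h + 1) := by rw [mul_add]; omega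
    rw [h4]; simp

lemma colRes_eq {n h i c : ℕ} (hn : 1 ≤ n) (hh : h = 2 * n + 1) (hi : i ≤ n) (hc : 1 ≤ c) :
    colRes h c = i ↔ c % h = i + 1 ∨ c % h + i = h ∨ (c % h = 0 ∧ i = 0) := by
  unfold colRes
  obtain ⟨c, rfl⟩ : ∃ d, c = d + 1 := ⟨c - 1, by omega⟩
  rw [Nat.add_sub_cancel]
  rcases mod_succ h c (by omega) with ⟨h1, h2⟩ | ⟨h1, h2⟩
  · rw [h1]; simp; omega
  · rw [Nat.mod_eq_of_lt (show h - (c + 1) % h < h by omega)]; omega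

lemma colRes_one {n h : ℕ} (hn : 1 ≤ n) (hh : h = 2 * n + 1) : colRes h 1 = 0 := by
  simp [colRes]

lemma res_succ {n h i c : ℕ} (hn : 1 ≤ n) (hh : h = 2 * n + 1) (hi : i ≤ n) (hc : 1 ≤ c)
    (h1 : colRes h c = i) (h2 : colRes h (c + 1) = i) : c % h = 0 ∧ i = 0 := by
  rw [colRes_eq hn hh hi hc] at h1
  rw [colRes_eq hn hh hi (by omega)] at h2
  rcases mod_succ h c (by omega) with ⟨h3, h4⟩ | ⟨h3, h4⟩ <;> omega

lemma res_three {n h i c : ℕ} (hn : 1 ≤ n) (hh : h = 2 * n + 1) (hi : i ≤ n) (hc : 1 ≤ c)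
    (h1 : colRes h c = i) (h2 : colRes h (c + 1) = i) (h3 : colRes h (c + 2) = i) : False := by
  have a := (res_succ hn hh hi hc h1 h2).1
  have b := (res_succ hn hh hi (by omega) h2 h3).1
  rcases mod_succ h c (by omega) with ⟨h3, h4⟩ | ⟨h3, h4⟩ <;> omega

lemma not_mod_succ {n h c : ℕ} (hn : 1 ≤ n) (hh : h = 2 * n + 1) (h1 : c % h = 0)
    (h2 : (c + 1) % h = 0) : False := by
  rcases mod_succ h c (by omega) with ⟨h3, h4⟩ | ⟨h3, h4⟩ <;> omega

lemma addable_iff {n h i : ℕ} (hn : 1 ≤ n) (hh : h = 2 * n + 1) (hi : i ≤ n) {lam : BPartition}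
    (hl : IsHStrict h lam) (r c : ℕ) :
    Addable h i lam (r, c) ↔ lam.parts r < c ∧
      (∀ c', lam.parts r < c' → c' ≤ c → colRes h c' = i) ∧
      (∀ s, r = s + 1 → okP h c (lam.parts s)) := by
  have hl' := (hstrict_iff h lam).1 hl
  constructor
  · rintro ⟨h1, h2, nu, h3, h4, h5, h6⟩
    rw [diagram_subset] at h4
    rw [mem_diagram] at h5 h2
    simp only at h1
    have h7 : ∀ r' c', lam.parts r' < c' → c' ≤ nu.parts r' → colRes h c' = i := fun r' c' a b =>
      h6 (r', c') ⟨by omega, b⟩ (by rw [mem_diagram]; omega)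
    refine ⟨by omega, fun c' a b => h7 r c' a (by omega), ?_⟩
    rintro s rfl
    have h3' := (hstrict_iff h nu).1 h3 s
    have hls := hl' s
    unfold okP at *
    by_contra hcon
    have e1 : lam.parts s ≤ c := by omega
    have hc0 : c % h = 0 := by
      rcases Nat.lt_or_ge c (nu.parts s) with h8 | h8
      · exact (res_succ hn hh hi (by omega) h1 (h7 s (c + 1) (by omega) (by omega))).1
      · have : nu.parts s = c := by omega
        rw [this] at h3'
        omega
    have e2 : lam.parts s < c := by
      rcases Nat.lt_or_ge (lam.parts s) c with h8 | h8
      · exact h8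
      · have : lam.parts s = c := by omega
        rw [this] at hcon
        omega
    obtain ⟨d, rfl⟩ : ∃ d, c = d + 1 := ⟨c - 1, by omega⟩
    have hd0 : 1 ≤ d := by
      rcases Nat.eq_zero_or_pos d with rfl | h8
      · rw [Nat.mod_eq_of_lt (by omega)] at hc0; omega
      · exact h8
    have e3 : ¬ d % h = 0 := fun h9 => not_mod_succ hn hh h9 hc0
    have e4 : ¬ colRes h d = i := fun h9 => e3 (res_succ hn hh hi hd0 h9 h1).1
    have e5 : ¬ lam.parts (s + 1) < d := fun h9 => e4 (h7 (s + 1) d h9 (by omega))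
    have e6 : lam.parts s = d := by omega
    rw [e6] at hls
    omega
  · rintro ⟨h1, h2, h3⟩
    obtain ⟨R, hR⟩ := exists_bound lam
    obtain ⟨nu, hnu, hs⟩ := mkP h (fun s => if s = r then c else lam.parts s) (R + r + 1)
      (fun s hs => by rw [if_neg (by omega)]; exact hR s (by omega)) (by
        intro s
        have hls := hl' s
        by_cases a : s + 1 = r
        · rw [if_pos a, if_neg (by omega)]
          exact h3 s a.symm
        · rw [if_neg a]
          split_ifs with b
          · subst b
            left
            unfold okP at hls
            omega
          · exact hls)
    refine ⟨h2 c h1 le_rfl, by rw [mem_diagram]; omega, nu, hs, ?_, ?_, ?_⟩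
    · rw [diagram_subset]
      intro s
      rw [hnu]
      split_ifs with b
      · subst b; exact h1.le
      · exact le_rfl
    · rw [mem_diagram, hnu, if_pos rfl]; omega
    · rintro ⟨s, d⟩ hy hy'
      rw [mem_diagram, hnu] at hy
      rw [mem_diagram] at hy'
      split_ifs at hy with b
      · subst b
        exact h2 d (by omega) (by omega)
      · omega

lemma removable_iff {n h i : ℕ} (hn : 1 ≤ n) (hh : h = 2 * n + 1) (hi : i ≤ n) {lam : BPartition}
    (hl : IsHStrict h lam) (r c : ℕ) :
    Removable h i lam (r, c) ↔ 1 ≤ c ∧ c ≤ lam.parts r ∧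
      (∀ c', c ≤ c' → c' ≤ lam.parts r → colRes h c' = i) ∧
      okP h (lam.parts (r + 1)) (c - 1) := by
  have hl' := (hstrict_iff h lam).1 hl
  constructor
  · rintro ⟨h2, mu, h3, h4, h5, h6⟩
    rw [diagram_subset] at h4
    rw [mem_diagram] at h5 h2
    have h7 : ∀ r' c', 1 ≤ c' → mu.parts r' < c' → c' ≤ lam.parts r' → colRes h c' = i :=
      fun r' c' z a b => h6 (r', c') ⟨z, b⟩ (by rw [mem_diagram]; omega)
    refine ⟨h2.1, h2.2, fun c' a b => h7 r c' (by omega) (by omega) b, ?_⟩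
    obtain ⟨d, rfl⟩ : ∃ d, c = d + 1 := ⟨c - 1, by omega⟩
    have h3' := (hstrict_iff h mu).1 h3 r
    have hls := hl' r
    have hls1 := h4 (r + 1)
    rw [Nat.add_sub_cancel]
    unfold okP at *
    have hc := h7 r (d + 1) (by omega) (by omega) (by omega)
    by_contra hcon
    have e1 : d ≤ lam.parts (r + 1) := by omega
    have hd0 : d % h = 0 := by
      rcases Nat.lt_or_ge (mu.parts (r + 1)) d with h8 | h8
      · exact (res_succ hn hh hi (by omega) (h7 (r + 1) d (by omega) h8 e1) hc).1
      · have : mu.parts r = d := by omega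
        rw [this] at h3'
        omega
    have e2 : lam.parts (r + 1) ≠ d := fun h8 => hcon (Or.inr ⟨h8, hd0⟩)
    have e3 : ¬ (d + 1) % h = 0 := not_mod_succ hn hh hd0
    have e4 : ¬ d + 2 ≤ lam.parts r := fun h9 =>
      e3 (res_succ hn hh hi (by omega) hc (h7 r (d + 2) (by omega) (by omega) h9)).1
    have e5 : lam.parts r = d + 1 := by omega
    rw [e5] at hls
    omega
  · rintro ⟨h0, h1, h2, h3⟩
    obtain ⟨R, hR⟩ := exists_bound lam
    obtain ⟨nu, hnu, hs⟩ := mkP h (fun s => if s = r then c - 1 else lam.parts s) (R + r + 1)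
      (fun s hs => by rw [if_neg (by omega)]; exact hR s (by omega)) (by
        intro s
        have hls := hl' s
        by_cases a : s = r
        · rw [if_pos a, if_neg (by omega), a]
          exact h3
        · rw [if_neg a]
          split_ifs with b
          · subst b
            left
            unfold okP at hls
            omega
          · exact hls)
    refine ⟨⟨h0, h1⟩, nu, hs, ?_, ?_, ?_⟩
    · rw [diagram_subset]
      intro s
      rw [hnu]
      split_ifs with b
      · subst b; omega
      · exact le_rfl
    · rw [mem_diagram, hnu, if_pos rfl]; omega
    · rintro ⟨s, d⟩ hy hy'
      rw [mem_diagram, hnu] at hy'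
      rw [mem_diagram] at hy
      split_ifs at hy' with b
      · subst b
        exact h2 d (by omega) (by omega)
      · omega

end BPartition
namespace BPartition
section Bracket
open Classical

/-- normal elements of an abstract signed word -/
noncomputable def nset {α : Type*} (le : α → α → Prop) (s : Finset α) (f : α → ℤ) : Finset α :=
  s.filter fun x => ∀ z, le z x → 0 < ∑ y ∈ s.filter (fun y => le z y ∧ le y x), f y

def IsInit {α : Type*} (le : α → α → Prop) (s U : Finset α) : Prop :=
  U ⊆ s ∧ ∀ x ∈ U, ∀ y ∈ s, le y x → y ∈ U

lemma nset_spec {α : Type*} [LinearOrder α] (le : α → α → Prop)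
    (hle : ∀ x y, le x y ↔ x ≤ y) (f : α → ℤ) (s : Finset α) 
    (hf : ∀ x ∈ s, f x ≤ 1) :
    (∀ U, IsInit le s U → ∑ y ∈ U, f y ≤ ((nset le s f).card : ℤ)) ∧
    ∃ U, IsInit le s U ∧ ∑ y ∈ U, f y = ((nset le s f).card : ℤ) := by
  induction s using Finset.induction_on_max with
  | empty =>
    constructor
    · rintro U ⟨h1, -⟩
      rw [Finset.subset_empty.1 h1]; simp
    · exact ⟨∅, ⟨by simp, by simp⟩, by simp [nset]⟩
  | insert m t hm ih =>
    obtain ⟨ih1, V, hV, hVe⟩ := ih fun x hx => hf x (Finset.mem_insert_of_mem hx)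
    have hmt : m ∉ t := fun h => lt_irrefl _ (hm m h)
    have hfm := hf m (Finset.mem_insert_self m t)
    have hw : ∀ x ∈ t, ∀ z, (insert m t).filter (fun y => le z y ∧ le y x) =
        t.filter (fun y => le z y ∧ le y x) := by
      intro x hx z
      rw [Finset.filter_insert, if_neg]
      rintro ⟨-, h2⟩
      exact absurd (hm x hx) (not_lt.2 ((hle _ _).1 h2))
    have hext : ∀ U, IsInit le t U → IsInit le (insert m t) U := by
      rintro U ⟨h1, h2⟩
      refine ⟨h1.trans (Finset.subset_insert _ _), fun x hx y hy hyx => ?_⟩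
      rcases Finset.mem_insert.1 hy with rfl | hy
      · exact absurd (hm x (h1 hx)) (not_lt.2 ((hle _ _).1 hyx))
      · exact h2 x hx y hy hyx
    have htt : IsInit le t t := ⟨subset_rfl, fun x hx y hy _ => hy⟩
    have hss : IsInit le (insert m t) (insert m t) := ⟨subset_rfl, fun x hx y hy _ => hy⟩
    have hcases : ∀ U, IsInit le (insert m t) U → IsInit le t U ∨ U = insert m t := by
      rintro U ⟨h1, h2⟩
      by_cases hmU : m ∈ U
      · right
        refine le_antisymm h1 fun y hy => h2 m hmU y hy ((hle _ _).2 ?_)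
        rcases Finset.mem_insert.1 hy with rfl | hy
        · exact le_rfl
        · exact (hm y hy).le
      · left
        refine ⟨fun x hx => ?_, fun x hx y hy hyx => h2 x hx y (Finset.mem_insert_of_mem hy) hyx⟩
        rcases Finset.mem_insert.1 (h1 hx) with rfl | hy
        · exact absurd hx hmU
        · exact hy
    have hsum : ∑ y ∈ insert m t, f y = f m + ∑ y ∈ t, f y := Finset.sum_insert hmt
    have hsplit : ∀ z, z ≤ m → ∑ y ∈ insert m t, f y =
        ∑ y ∈ (insert m t).filter (fun y => le z y ∧ le y m), f y +
          ∑ y ∈ t.filter (fun y => y < z), f y := by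
      intro z hz
      rw [← Finset.sum_filter_add_sum_filter_not (insert m t) (fun y => le z y ∧ le y m)]
      congr 1
      refine Finset.sum_congr ?_ fun _ _ => rfl
      ext y
      simp only [Finset.mem_filter, Finset.mem_insert]
      constructor
      · rintro ⟨rfl | hy, h2⟩
        · exact absurd ⟨(hle _ _).2 hz, (hle _ _).2 le_rfl⟩ h2
        · refine ⟨hy, ?_⟩
          by_contra h3
          exact h2 ⟨(hle _ _).2 (not_lt.1 h3), (hle _ _).2 (hm y hy).le⟩
      · rintro ⟨hy, h2⟩
        exact ⟨Or.inr hy, fun h3 => absurd h2 (not_lt.2 ((hle _ _).1 h3.1))⟩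
    have hinit : ∀ z, IsInit le t (t.filter fun y => y < z) := by
      intro z
      refine ⟨Finset.filter_subset _ _, fun x hx y hy hyx => ?_⟩
      simp only [Finset.mem_filter] at hx ⊢
      exact ⟨hy, ((hle _ _).1 hyx).trans_lt hx.2⟩
    by_cases hN : ∀ z, le z m → 0 < ∑ y ∈ (insert m t).filter (fun y => le z y ∧ le y m), f y
    · have hset : nset le (insert m t) f = insert m (nset le t f) := by
        unfold nset
        rw [Finset.filter_insert, if_pos hN]
        congr 1
        refine Finset.filter_congr fun x hx => ?_
        simp only [hw x hx]
      have hcard : ((nset le (insert m t) f).card : ℤ) = (nset le t f).card + 1 := by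
        rw [hset, Finset.card_insert_of_notMem]
        · push_cast; rfl
        · exact fun h => hmt (Finset.mem_filter.1 h).1
      have htot : ((nset le t f).card : ℤ) < ∑ y ∈ insert m t, f y := by
        rw [← hVe]
        have hne : ((insert m t) \ V).Nonempty :=
          ⟨m, by simp only [Finset.mem_sdiff, Finset.mem_insert_self, true_and]
                 exact fun h => hmt (hV.1 h)⟩
        set z := ((insert m t) \ V).min' hne with hz
        have hzm := Finset.min'_mem _ hne
        rw [← hz, Finset.mem_sdiff] at hzm
        have hzle : z ≤ m := by
          rcases Finset.mem_insert.1 hzm.1 with h | h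
          · exact h.le
          · exact (hm z h).le
        have hVz : V = t.filter (fun y => y < z) := by
          ext y
          simp only [Finset.mem_filter]
          constructor
          · intro hy
            refine ⟨hV.1 hy, ?_⟩
            by_contra h3
            exact hzm.2 ((hext V hV).2 y hy z hzm.1 ((hle _ _).2 (not_lt.1 h3)))
          · rintro ⟨hy, h2⟩
            by_contra h3
            have : z ≤ y := Finset.min'_le _ _ (by
              simp only [Finset.mem_sdiff]
              exact ⟨Finset.mem_insert_of_mem hy, h3⟩)
            exact absurd h2 (not_lt.2 this)
        rw [hsplit z hzle, ← hVz]
        have := hN z ((hle _ _).2 hzle)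
        omega
      have h3 := ih1 t htt
      refine ⟨fun U hU => ?_, insert m t, hss, by omega⟩
      rcases hcases U hU with h4 | rfl
      · have := ih1 U h4; omega
      · omega
    · have hset : nset le (insert m t) f = nset le t f := by
        unfold nset
        rw [Finset.filter_insert, if_neg hN]
        refine Finset.filter_congr fun x hx => ?_
        simp only [hw x hx]
      rw [hset]
      refine ⟨fun U hU => ?_, V, hext V hV, hVe⟩
      rcases hcases U hU with h4 | rfl
      · exact ih1 U h4
      · push Not at hN
        obtain ⟨z, hz, hle'⟩ := hN
        have := hsplit z ((hle _ _).1 hz)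
        have := ih1 _ (hinit z)
        omega

@[reducible]
def dualLO (α : Type*) [LinearOrder α] : LinearOrder α := inferInstanceAs (LinearOrder αᵒᵈ)

lemma bracket {α : Type*} [LinearOrder α] (le : α → α → Prop)
    (hle : ∀ x y, le x y ↔ x ≤ y) (f : α → ℤ) (s : Finset α)
    (hf : ∀ x ∈ s, f x ≤ 1 ∧ -1 ≤ f x) :
    ((nset le s f).card : ℤ) - ((nset (fun x y => le y x) s (fun x => - f x)).card : ℤ)
      = ∑ y ∈ s, f y := by
  obtain ⟨h1, U, hU, hUe⟩ := nset_spec le hle f s fun x hx => (hf x hx).1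
  obtain ⟨h2, V, hV, hVe⟩ := @nset_spec α (dualLO α) (fun x y => le y x) (fun x y => hle y x)
    (fun x => - f x) s
    fun x hx => by have := (hf x hx).2; show - f x ≤ 1; omega
  have hUc : IsInit (fun x y => le y x) s (s \ U) := by
    refine ⟨Finset.sdiff_subset, fun x hx y hy hyx => ?_⟩
    have hx := Finset.mem_sdiff.1 hx
    exact Finset.mem_sdiff.2 ⟨hy, fun h => hx.2 (hU.2 y h x hx.1 hyx)⟩
  have hVc : IsInit le s (s \ V) := by
    refine ⟨Finset.sdiff_subset, fun x hx y hy hyx => ?_⟩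
    have hx := Finset.mem_sdiff.1 hx
    exact Finset.mem_sdiff.2 ⟨hy, fun h => hx.2 (hV.2 y h x hx.1 hyx)⟩
  have a := h2 _ hUc
  have b := h1 _ hVc
  have a' := Finset.sum_sdiff (f := f) hU.1
  have b' := Finset.sum_sdiff (f := f) hV.1
  rw [Finset.sum_neg_distrib] at a hVe
  omega

lemma rank_card {α : Type*} [LinearOrder α] (le : α → α → Prop)
    (hle : ∀ x y, le x y ↔ x ≤ y) (C : Finset α) (d : ℕ) (hd : d ≤ C.card) :
    (C.filter fun x => (C.filter fun y => le y x).card ≤ d).card = d := by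
  induction C using Finset.induction_on_max with
  | empty => simp at hd; simp [hd]
  | insert m t hm ih =>
    have hmt : m ∉ t := fun h => lt_irrefl _ (hm m h)
    have hcard := Finset.card_insert_of_notMem hmt
    rcases Nat.lt_or_ge t.card d with h1 | h1
    · rw [Finset.filter_true_of_mem]
      · omega
      · intro x hx
        exact (Finset.card_filter_le _ _).trans (by omega)
    · rw [Finset.filter_insert, if_neg]
      · conv_rhs => rw [← ih h1]
        refine congrArg Finset.card (Finset.filter_congr fun x hx => ?_)
        rw [Finset.filter_insert, if_neg]
        rw [hle]
        exact not_le.2 (hm x hx)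
      · rw [Finset.filter_true_of_mem]
        · omega
        · intro x hx
          rw [hle]
          rcases Finset.mem_insert.1 hx with h | h
          · exact h.le
          · exact (hm x h).le

lemma rank_ncard {α : Type*} [LinearOrder α] (le : α → α → Prop)
    (hle : ∀ x y, le x y ↔ x ≤ y) (C : Set α) (hC : C.Finite) (d : ℕ) (hd : d ≤ C.ncard) :
    Set.ncard {x | x ∈ C ∧ Set.ncard {y | y ∈ C ∧ le y x} ≤ d} = d := by
  obtain ⟨C, rfl⟩ := hC.exists_finset_coe
  rw [Set.ncard_coe_finset] at hd
  conv_rhs => rw [← rank_card le hle C d hd]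
  rw [← Set.ncard_coe_finset]
  congr 1
  ext x
  simp only [Set.mem_ofPred_eq, Finset.coe_filter, Finset.mem_coe]
  refine and_congr_right fun _ => ?_
  rw [← Set.ncard_coe_finset (C.filter _)]
  simp

/-- abstract normal set -/
def absN {α : Type*} (le : α → α → Prop) (A R : Set α) : Set α :=
  {x | x ∈ R ∧ ∀ z, le z x →
    Set.ncard {y | y ∈ A ∧ le z y ∧ le y x} < Set.ncard {y | y ∈ R ∧ le z y ∧ le y x}}

lemma absN_card {α : Type*} [LinearOrder α] (le : α → α → Prop)
    (hrefl : ∀ x, le x x) (hanti : ∀ x y, le x y → le y x → x = y) (A R : Finset α)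
    (hd : Disjoint A R) (f : α → ℤ) (hR : ∀ x ∈ R, f x = 1) (hA : ∀ x ∈ A, f x = -1) :
    Set.ncard (absN le (A : Set α) R) = (nset le (A ∪ R) f).card := by
  rw [← Set.ncard_coe_finset]
  congr 1
  have hw : ∀ z x, ∑ y ∈ (A ∪ R).filter (fun y => le z y ∧ le y x), f y =
      (Set.ncard {y | y ∈ (R : Set α) ∧ le z y ∧ le y x} : ℤ) -
        Set.ncard {y | y ∈ (A : Set α) ∧ le z y ∧ le y x} := by
    intro z x
    rw [Finset.filter_union, Finset.sum_union (Finset.disjoint_filter_filter hd)]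
    rw [Finset.sum_congr rfl (fun y hy => hA y (Finset.mem_filter.1 hy).1)]
    rw [Finset.sum_congr rfl (fun y hy => hR y (Finset.mem_filter.1 hy).1)]
    have e : ∀ B : Finset α, {y | y ∈ (B : Set α) ∧ le z y ∧ le y x} =
      ((B.filter (fun y => le z y ∧ le y x) : Finset α) : Set α) := by intro B; ext; simp
    rw [e, e, Set.ncard_coe_finset, Set.ncard_coe_finset]
    simp
    ring
  ext x
  simp only [absN, nset, Set.mem_ofPred_eq, Finset.coe_filter, hw, Finset.mem_union]
  constructor
  · rintro ⟨h1, h2⟩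
    exact ⟨Or.inr h1, fun z hz => by have := h2 z hz; omega⟩
  · rintro ⟨h1, h2⟩
    refine ⟨?_, fun z hz => by have := h2 z hz; omega⟩
    rcases h1 with h1 | h1
    · exfalso
      have h3 := h2 x (hrefl x)
      have : {y | y ∈ (R : Set α) ∧ le x y ∧ le y x} = ∅ := by
        ext y
        simp only [Set.mem_ofPred_eq, Set.mem_empty_iff_false, iff_false]
        rintro ⟨h4, h5, h6⟩
        rw [← hanti x y h5 h6] at h4
        exact Finset.disjoint_left.1 hd h1 h4
      rw [this] at h3
      simp at h3
      omega
    · exact h1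

lemma bracket_sets {α : Type*} [LinearOrder α] (le : α → α → Prop)
    (hle : ∀ x y, le x y ↔ x ≤ y) (A R : Set α) (hA : A.Finite) (hR : R.Finite)
    (hd : Disjoint A R) :
    (Set.ncard (absN le A R) : ℤ) - Set.ncard (absN (fun x y => le y x) R A) =
      R.ncard - A.ncard := by
  obtain ⟨A, rfl⟩ := hA.exists_finset_coe
  obtain ⟨R, rfl⟩ := hR.exists_finset_coe
  rw [Finset.disjoint_coe] at hd
  have hnot : ∀ x ∈ A, x ∉ R := fun x hx => Finset.disjoint_left.1 hd hx
  set f : α → ℤ := fun x => if x ∈ R then 1 else -1 with hf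
  have f1 : ∀ x ∈ R, f x = 1 := fun x hx => by simp [hf, hx]
  have f2 : ∀ x ∈ A, f x = -1 := fun x hx => by simp [hf, hnot x hx]
  rw [absN_card le (fun x => (hle x x).2 le_rfl)
    (fun x y h1 h2 => le_antisymm ((hle _ _).1 h1) ((hle _ _).1 h2)) A R hd f f1 f2]
  rw [absN_card (fun x y => le y x) (fun x => (hle x x).2 le_rfl)
    (fun x y h1 h2 => le_antisymm ((hle _ _).1 h2) ((hle _ _).1 h1)) R A hd.symm (fun x => - f x)
    (fun x hx => by simp [f2 x hx]) (fun x hx => by simp [f1 x hx])]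
  rw [Finset.union_comm R A, bracket le hle f (A ∪ R)]
  · rw [Finset.sum_union hd, Finset.sum_congr rfl f2, Finset.sum_congr rfl f1]
    simp only [Set.ncard_coe_finset]
    simp
    ring
  · intro x hx
    simp only [hf]
    split_ifs <;> omega

end Bracket
end BPartition
namespace BPartition

section
open Classical

@[reducible]
noncomputable def posLO : LinearOrder (ℕ × ℕ) where
  le := posLE
  lt x y := posLE x y ∧ ¬ posLE y x
  min x y := if posLE x y then x else y
  max x y := if posLE x y then y else x
  le_refl x := Or.inr ⟨rfl, le_rfl⟩
  le_trans x y z h1 h2 := by unfold posLE at *; omega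
  le_antisymm x y h1 h2 := by
    unfold posLE at *
    exact Prod.ext (by omega) (by omega)
  le_total x y := by unfold posLE; omega
  toDecidableLE := Classical.decRel _
end

lemma add_col_le {n h i : ℕ} (hn : 1 ≤ n) (hh : h = 2 * n + 1) (hi : i ≤ n) {v c : ℕ}
    (H : ∀ c', v < c' → c' ≤ c → colRes h c' = i) : c ≤ v + 2 := by
  by_contra hc
  exact res_three hn hh hi (c := v + 1) (by omega) (H _ (by omega) (by omega))
    (H _ (by omega) (by omega)) (H _ (by omega) (by omega))

lemma rem_col_ge {n h i : ℕ} (hn : 1 ≤ n) (hh : h = 2 * n + 1) (hi : i ≤ n) {u c : ℕ} (hc : 1 ≤ c)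
    (H : ∀ c', c ≤ c' → c' ≤ u → colRes h c' = i) : u ≤ c + 1 := by
  by_contra hc
  exact res_three hn hh hi (c := c) (by omega) (H _ (by omega) (by omega))
    (H _ (by omega) (by omega)) (H _ (by omega) (by omega))

lemma diagram_finite (lam : BPartition) : (diagram lam).Finite := by
  obtain ⟨R, hR⟩ := exists_bound lam
  refine ((Set.finite_lt_nat R).prod (Set.finite_le_nat (lam.parts 0))).subset ?_
  rintro ⟨r, c⟩ ⟨h1, h2⟩
  simp only at h1 h2
  refine ⟨?_, h2.trans (anti lam (Nat.zero_le r))⟩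
  by_contra h3
  have := hR r (by simpa using h3)
  omega

lemma add_row_le {n h i : ℕ} (hn : 1 ≤ n) (hh : h = 2 * n + 1) (hi : i ≤ n) {lam : BPartition}
    (hl : IsHStrict h lam) {R : ℕ} (hR : ∀ r, R ≤ r → lam.parts r = 0) {r c : ℕ}
    (H : Addable h i lam (r, c)) : r ≤ R := by
  rw [addable_iff hn hh hi hl] at H
  by_contra h1
  have := H.2.2 (r - 1) (by omega)
  rw [hR (r - 1) (by omega)] at this
  unfold okP at this
  omega

lemma add_finite {n h i : ℕ} (hn : 1 ≤ n) (hh : h = 2 * n + 1) (hi : i ≤ n) {lam : BPartition}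
    (hl : IsHStrict h lam) : {x | Addable h i lam x}.Finite := by
  obtain ⟨R, hR⟩ := exists_bound lam
  refine ((Set.finite_le_nat R).prod (Set.finite_le_nat (lam.parts 0 + 2))).subset ?_
  rintro ⟨r, c⟩ H
  refine ⟨add_row_le hn hh hi hl hR H, ?_⟩
  have H' := (addable_iff hn hh hi hl r c).1 H
  have := add_col_le hn hh hi H'.2.1
  have := anti lam (Nat.zero_le r)
  show c ≤ lam.parts 0 + 2
  omega

lemma rem_finite {h i : ℕ} {lam : BPartition} : {x | Removable h i lam x}.Finite :=
  (diagram_finite lam).subset fun _ hx => hx.1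

lemma add_rem_disj {h i : ℕ} {lam : BPartition} :
    Disjoint {x | Addable h i lam x} {x | Removable h i lam x} :=
  Set.disjoint_left.2 fun _ h1 h2 => h1.2.1 h2.1

lemma normal_eq (h i : ℕ) (lam : BPartition) : {x | Normal h i lam x} =
    absN posLE {x | Addable h i lam x} {x | Removable h i lam x} := rfl

lemma conormal_eq (h i : ℕ) (lam : BPartition) : {x | Conormal h i lam x} =
    absN (fun x y => posLE y x) {x | Removable h i lam x} {x | Addable h i lam x} := by
  ext x
  refine and_congr_right fun _ => forall_congr' fun z => ?_
  have e : ∀ P : ℕ × ℕ → Prop, {y | P y ∧ posLE x y ∧ posLE y z} =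
      {y | y ∈ {y | P y} ∧ posLE y z ∧ posLE x y} := by
    intro P; ext y
    exact and_congr_right fun _ => and_comm
  rw [e, e]

lemma normal_sub_conormal {n h i : ℕ} (hn : 1 ≤ n) (hh : h = 2 * n + 1) (hi : i ≤ n)
    {lam : BPartition} (hl : IsHStrict h lam) :
    (Set.ncard {x | Normal h i lam x} : ℤ) - Set.ncard {x | Conormal h i lam x} =
      Set.ncard {x | Removable h i lam x} - Set.ncard {x | Addable h i lam x} := by
  rw [normal_eq, conormal_eq]
  exact @bracket_sets _ posLO posLE (fun _ _ => Iff.rfl) _ _ (add_finite hn hh hi hl) rem_finite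
    add_rem_disj

lemma addSet {n h i : ℕ} (hn : 1 ≤ n) (hh : h = 2 * n + 1) (hi : i ≤ n)
    {lam : BPartition} (hl : IsHStrict h lam) (A : Set (ℕ × ℕ))
    (hA : ∀ x ∈ A, Addable h i lam x)
    (hcl : ∀ r c, (r, c + 1) ∈ A → Addable h i lam (r, c) → (r, c) ∈ A) :
    ∃ mu : BPartition, IsHStrict h mu ∧ diagram mu = diagram lam ∪ A := by
  classical
  have hl' := (hstrict_iff h lam).1 hl
  obtain ⟨R, hR⟩ := exists_bound lam
  set f : ℕ → ℕ := fun r => if (r, lam.parts r + 2) ∈ A then lam.parts r + 2 else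
    if (r, lam.parts r + 1) ∈ A then lam.parts r + 1 else lam.parts r with hf
  have f1 : ∀ r, lam.parts r ≤ f r := by
    intro r; simp only [hf]; split_ifs <;> omega
  have f2 : ∀ r, f r = lam.parts r ∨ (r, f r) ∈ A := by
    intro r; simp only [hf]; split_ifs with a b
    · exact Or.inr a
    · exact Or.inr b
    · exact Or.inl rfl
  have f3 : ∀ r c, (r, c) ∈ A → lam.parts r < c ∧ c ≤ f r := by
    intro r c hc
    have h1 := (addable_iff hn hh hi hl r c).1 (hA _ hc)
    have h2 := add_col_le hn hh hi h1.2.1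
    refine ⟨h1.1, ?_⟩
    rcases (show c = lam.parts r + 1 ∨ c = lam.parts r + 2 by omega) with rfl | rfl
    · simp only [hf]; split_ifs <;> omega
    · simp only [hf, if_pos hc]; omega
  have f4 : ∀ r c, lam.parts r < c → c ≤ f r → (r, c) ∈ A := by
    intro r c h1 h2
    rcases f2 r with h3 | h3
    · omega
    have h4 := (addable_iff hn hh hi hl r (f r)).1 (hA _ h3)
    have h5 := add_col_le hn hh hi h4.2.1
    rcases (show c = f r ∨ c + 1 = f r by omega) with h6 | h6
    · rw [h6]; exact h3
    · refine hcl r c (by rw [h6]; exact h3) ?_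
      rw [addable_iff hn hh hi hl]
      refine ⟨h1, fun c' a b => h4.2.1 c' a (by omega), fun s hs => ?_⟩
      have := h4.2.2 s hs
      unfold okP at *
      omega
  obtain ⟨mu, hmu, hs⟩ := mkP h f (R + 1) (by
      intro r hr
      rcases f2 r with h3 | h3
      · rw [h3]; exact hR r (by omega)
      · have := add_row_le hn hh hi hl hR (hA _ h3); omega) (by
      intro r
      have h0 := f1 r
      have h5 : okP h (f (r + 1)) (lam.parts r) := by
        rcases f2 (r + 1) with h3 | h3
        · rw [h3]; exact hl' r
        · exact ((addable_iff hn hh hi hl _ _).1 (hA _ h3)).2.2 r rfl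
      rcases Nat.lt_or_ge (lam.parts r) (f r) with h6 | h6
      · left
        unfold okP at h5
        omega
      · rw [show f r = lam.parts r by omega]; exact h5)
  refine ⟨mu, hs, ?_⟩
  ext ⟨r, c⟩
  rw [Set.mem_union, mem_diagram, mem_diagram, hmu]
  constructor
  · rintro ⟨h1, h2⟩
    rcases Nat.lt_or_ge (lam.parts r) c with h3 | h3
    · exact Or.inr (f4 r c h3 h2)
    · exact Or.inl ⟨h1, h3⟩
  · rintro (⟨h1, h2⟩ | h1)
    · exact ⟨h1, h2.trans (f1 r)⟩
    · have := f3 r c h1; omega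

lemma remSet {n h i : ℕ} (hn : 1 ≤ n) (hh : h = 2 * n + 1) (hi : i ≤ n)
    {lam : BPartition} (hl : IsHStrict h lam) (B : Set (ℕ × ℕ))
    (hB : ∀ x ∈ B, Removable h i lam x)
    (hcl : ∀ r c, (r, c) ∈ B → Removable h i lam (r, c + 1) → (r, c + 1) ∈ B) :
    ∃ mu : BPartition, IsHStrict h mu ∧ diagram mu = diagram lam \ B := by
  classical
  have hl' := (hstrict_iff h lam).1 hl
  obtain ⟨R, hR⟩ := exists_bound lam
  set f : ℕ → ℕ := fun r => if (r, lam.parts r - 1) ∈ B then lam.parts r - 2 else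
    if (r, lam.parts r) ∈ B then lam.parts r - 1 else lam.parts r with hf
  have f0 : ∀ r c, (r, c) ∈ B → 1 ≤ c ∧ c ≤ lam.parts r ∧ lam.parts r ≤ c + 1 := by
    intro r c hc
    have h1 := (removable_iff hn hh hi hl r c).1 (hB _ hc)
    exact ⟨h1.1, h1.2.1, rem_col_ge hn hh hi h1.1 h1.2.2.1⟩
  have f1 : ∀ r, f r ≤ lam.parts r := by
    intro r; simp only [hf]; split_ifs <;> omega
  have f2 : ∀ r, f r = lam.parts r ∨ (r, f r + 1) ∈ B := by
    intro r; simp only [hf]; split_ifs with a b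
    · right
      have := f0 _ _ a
      rw [show lam.parts r - 2 + 1 = lam.parts r - 1 by omega]; exact a
    · right
      have := f0 _ _ b
      rw [show lam.parts r - 1 + 1 = lam.parts r by omega]; exact b
    · exact Or.inl rfl
  have f3 : ∀ r c, (r, c) ∈ B → f r < c ∧ c ≤ lam.parts r := by
    intro r c hc
    have h1 := f0 r c hc
    refine ⟨?_, h1.2.1⟩
    rcases (show c = lam.parts r ∨ c = lam.parts r - 1 by omega) with rfl | rfl
    · simp only [hf, if_pos hc]; split_ifs <;> omega
    · simp only [hf, if_pos hc]; omega
  have f4 : ∀ r c, f r < c → c ≤ lam.parts r → (r, c) ∈ B := by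
    intro r c h1 h2
    rcases f2 r with h3 | h3
    · omega
    have h4 := (removable_iff hn hh hi hl r (f r + 1)).1 (hB _ h3)
    have h5 := f0 _ _ h3
    rcases (show c = f r + 1 ∨ c = f r + 1 + 1 by omega) with h6 | h6
    · rw [h6]; exact h3
    · rw [h6]
      refine hcl r _ h3 ?_
      rw [removable_iff hn hh hi hl]
      refine ⟨by omega, by omega, fun c' a b => h4.2.2.1 c' (by omega) b, ?_⟩
      have := h4.2.2.2
      unfold okP at *
      omega
  obtain ⟨mu, hmu, hs⟩ := mkP h f R (by
      intro r hr
      have := f1 r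
      have := hR r hr
      omega) (by
      intro r
      have h0 := f1 (r + 1)
      have h5 : okP h (lam.parts (r + 1)) (f r) := by
        rcases f2 r with h3 | h3
        · rw [h3]; exact hl' r
        · exact ((removable_iff hn hh hi hl _ _).1 (hB _ h3)).2.2.2
      rcases Nat.lt_or_ge (f (r + 1)) (lam.parts (r + 1)) with h6 | h6
      · left
        unfold okP at h5
        omega
      · rw [show f (r + 1) = lam.parts (r + 1) by omega]; exact h5)
  refine ⟨mu, hs, ?_⟩
  ext ⟨r, c⟩
  rw [Set.mem_sdiff, mem_diagram, mem_diagram, hmu]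
  constructor
  · rintro ⟨h1, h2⟩
    refine ⟨⟨h1, h2.trans (f1 r)⟩, fun h3 => ?_⟩
    have := f3 r c h3; omega
  · rintro ⟨⟨h1, h2⟩, h3⟩
    refine ⟨h1, ?_⟩
    by_contra h4
    exact h3 (f4 r c (by omega) h2)

/-- `(r,c)` is conormal as soon as `(r,c+1)` is conormal and `(r,c)` addable. -/
lemma conormal_left {n h i : ℕ} (hn : 1 ≤ n) (hh : h = 2 * n + 1) (hi : i ≤ n)
    {lam : BPartition} (hl : IsHStrict h lam) {r c : ℕ} (h1 : Conormal h i lam (r, c + 1))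
    (h2 : Addable h i lam (r, c)) : Conormal h i lam (r, c) := by
  have a1 := (addable_iff hn hh hi hl r c).1 h2
  have a2 := (addable_iff hn hh hi hl r (c + 1)).1 h1.1
  have hc0 := (res_succ hn hh hi (by omega) (a2.2.1 c (by omega) (by omega))
    (a2.2.1 (c + 1) (by omega) (by omega))).1
  -- no removable nodes strictly before (r,c+1) from (r,c) on
  have hno : ∀ y, Removable h i lam y → posLE (r, c) y → posLE (r, c + 1) y := by
    rintro ⟨s, d⟩ hy hp
    have b := (removable_iff hn hh hi hl s d).1 hy
    unfold posLE at *
    simp only at *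
    by_contra hcon
    have hd : d = c ∨ d = c + 1 := by omega
    rcases hd with rfl | rfl
    · have hs : s < r := by
        rcases Nat.lt_or_ge s r with h5 | h5
        · exact h5
        · have := anti lam h5; omega
      have e1 := rem_col_ge hn hh hi b.1 b.2.2.1
      have e2 := a2.2.2 (r - 1) (by omega)
      have e3 := anti lam (show s ≤ r - 1 by omega)
      have e4 : ¬ (d + 1) % h = 0 := not_mod_succ hn hh hc0
      unfold okP at e2
      rcases e2 with e2 | e2
      · omega
      · rw [← e2.1] at e2; exact e4 e2.2
    · have := anti lam (show r ≤ s by omega)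
      omega
  refine ⟨h2, fun z hz => ?_⟩
  by_cases hz' : posLE (r, c + 1) z
  · have h3 := h1.2 z hz'
    have e1 : {y | Removable h i lam y ∧ posLE (r, c) y ∧ posLE y z} ⊆
        {y | Removable h i lam y ∧ posLE (r, c + 1) y ∧ posLE y z} :=
      fun y hy => ⟨hy.1, hno y hy.1 hy.2.1, hy.2.2⟩
    have e2 : {y | Addable h i lam y ∧ posLE (r, c + 1) y ∧ posLE y z} ⊆
        {y | Addable h i lam y ∧ posLE (r, c) y ∧ posLE y z} := by
      rintro y ⟨u, v, w⟩
      refine ⟨u, ?_, w⟩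
      unfold posLE at *
      simp only at *
      omega
    have e3 := Set.ncard_le_ncard e1 (rem_finite.subset fun y hy => hy.1)
    have e4 := Set.ncard_le_ncard e2 ((add_finite hn hh hi hl).subset fun y hy => hy.1)
    omega
  · have e1 : {y | Removable h i lam y ∧ posLE (r, c) y ∧ posLE y z} = ∅ := by
      ext y
      simp only [Set.mem_ofPred_eq, Set.mem_empty_iff_false, iff_false]
      rintro ⟨u, v, w⟩
      have := hno y u v
      apply hz'
      unfold posLE at *
      omega
    rw [e1, Set.ncard_empty, Set.ncard_pos ((add_finite hn hh hi hl).subset fun y hy => hy.1)]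
    exact ⟨(r, c), h2, Or.inr ⟨rfl, le_rfl⟩, hz⟩

lemma normal_right {n h i : ℕ} (hn : 1 ≤ n) (hh : h = 2 * n + 1) (hi : i ≤ n)
    {lam : BPartition} (hl : IsHStrict h lam) {r c : ℕ} (h1 : Normal h i lam (r, c))
    (h2 : Removable h i lam (r, c + 1)) : Normal h i lam (r, c + 1) := by
  have a1 := (removable_iff hn hh hi hl r c).1 h1.1
  have a2 := (removable_iff hn hh hi hl r (c + 1)).1 h2
  have hc0 := (res_succ hn hh hi (by omega) (a1.2.2.1 c (by omega) (by omega))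
    (a1.2.2.1 (c + 1) (by omega) (by omega))).1
  have hno : ∀ y, Addable h i lam y → posLE y (r, c + 1) → posLE y (r, c) := by
    rintro ⟨s, d⟩ hy hp
    have b := (addable_iff hn hh hi hl s d).1 hy
    unfold posLE at *
    simp only at *
    by_contra hcon
    have hd : d = c ∨ d = c + 1 := by omega
    rcases hd with rfl | rfl
    · have := anti lam (show s ≤ r by omega)
      omega
    · have hs : r < s := by
        rcases Nat.lt_or_ge r s with h5 | h5
        · exact h5
        · have := anti lam h5; omega
      have e2 := b.2.2 (s - 1) (by omega)
      have e0 : s = r + 1 := by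
        by_contra h6
        have := anti lam (show r + 1 ≤ s - 1 by omega)
        have := a1.2.2.2
        unfold okP at *
        omega
      subst e0
      have e1 := add_col_le hn hh hi b.2.1
      have e3 := a1.2.2.2
      obtain ⟨k, rfl⟩ : ∃ k, c = k + 1 := ⟨c - 1, by omega⟩
      have e4 : ¬ k % h = 0 := fun h7 => not_mod_succ hn hh h7 hc0
      unfold okP at e3
      simp only [Nat.add_sub_cancel] at e3
      omega
  refine ⟨h2, fun z hz => ?_⟩
  by_cases hz' : posLE z (r, c)
  · have h3 := h1.2 z hz'
    have e1 : {y | Addable h i lam y ∧ posLE z y ∧ posLE y (r, c + 1)} ⊆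
        {y | Addable h i lam y ∧ posLE z y ∧ posLE y (r, c)} :=
      fun y hy => ⟨hy.1, hy.2.1, hno y hy.1 hy.2.2⟩
    have e2 : {y | Removable h i lam y ∧ posLE z y ∧ posLE y (r, c)} ⊆
        {y | Removable h i lam y ∧ posLE z y ∧ posLE y (r, c + 1)} := by
      rintro y ⟨u, v, w⟩
      refine ⟨u, v, ?_⟩
      unfold posLE at *
      simp only at *
      omega
    have e3 := Set.ncard_le_ncard e2 (rem_finite.subset fun y hy => hy.1)
    have e4 := Set.ncard_le_ncard e1 ((add_finite hn hh hi hl).subset fun y hy => hy.1)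
    omega
  · have e1 : {y | Addable h i lam y ∧ posLE z y ∧ posLE y (r, c + 1)} = ∅ := by
      ext y
      simp only [Set.mem_ofPred_eq, Set.mem_empty_iff_false, iff_false]
      rintro ⟨u, v, w⟩
      have := hno y u w
      apply hz'
      unfold posLE at *
      omega
    rw [e1, Set.ncard_empty, Set.ncard_pos (rem_finite.subset fun y hy => hy.1)]
    exact ⟨(r, c + 1), h2, hz, Or.inr ⟨rfl, le_rfl⟩⟩

/-- Main structural description of `psi`. -/
lemma psi_spec {n h i : ℕ} (hn : 1 ≤ n) (hh : h = 2 * n + 1) (hi : i ≤ n)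
    {lam : BPartition} (hl : IsHStrict h lam) :
    IsHStrict h (psi h i lam) ∧ ∃ A B : Set (ℕ × ℕ), A.Finite ∧ B.Finite ∧
      Disjoint (diagram lam) A ∧ Disjoint (diagram (psi h i lam)) B ∧
      diagram lam ∪ A = diagram (psi h i lam) ∪ B ∧
      (∀ x ∈ A ∪ B, 1 ≤ x.2 ∧ colRes h x.2 = i) ∧
      (A.ncard : ℤ) - B.ncard =
        Set.ncard {x | Addable h i lam x} - Set.ncard {x | Removable h i lam x} := by
  have hNC := normal_sub_conormal hn hh hi hl
  have key : ∀ mu, IsHStrict h mu → diagram mu = psiSet h i lam → psi h i lam = mu := by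
    intro mu _ hmu
    have hex : ∃ mu : BPartition, diagram mu = psiSet h i lam := ⟨mu, hmu⟩
    have : psi h i lam = hex.choose := by rw [psi, dif_pos hex]
    rw [this]
    exact diagram_inj (hex.choose_spec.trans hmu.symm)
  have fa := add_finite hn hh hi hl
  have fr : {x | Removable h i lam x}.Finite := rem_finite
  have fc : {x | Conormal h i lam x}.Finite := fa.subset fun x hx => hx.1
  have fn : {x | Normal h i lam x}.Finite := fr.subset fun x hx => hx.1
  by_cases hc : Set.ncard {x | Normal h i lam x} ≤ Set.ncard {x | Conormal h i lam x}
  · set d := Set.ncard {x | Conormal h i lam x} - Set.ncard {x | Normal h i lam x} with hd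
    set A := {x | Conormal h i lam x ∧ Set.ncard {y | Conormal h i lam y ∧ posLE y x} ≤ d} with hA
    have hset : psiSet h i lam = diagram lam ∪ A := by rw [psiSet, if_pos hc]
    have hcard : A.ncard = d := @rank_ncard _ posLO posLE (fun _ _ => Iff.rfl)
      {x | Conormal h i lam x} fc d (by omega)
    obtain ⟨mu, hs, hmu⟩ := addSet hn hh hi hl A (fun x hx => hx.1.1) (by
      rintro r c ⟨h1, h2⟩ h3
      refine ⟨conormal_left hn hh hi hl h1 h3, le_trans (Set.ncard_le_ncard ?_ ?_) h2⟩
      · rintro y ⟨u, v⟩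
        refine ⟨u, ?_⟩
        unfold posLE at *
        simp only at *
        omega
      · exact fc.subset fun y hy => hy.1)
    rw [key mu hs (hmu.trans hset.symm)]
    refine ⟨hs, A, ∅, fc.subset fun x hx => hx.1, Set.finite_empty, ?_, ?_, ?_, ?_, ?_⟩
    · exact Set.disjoint_right.2 fun x hx => hx.1.1.2.1
    · simp
    · simp [hmu]
    · rintro ⟨r, c⟩ hx
      rw [Set.union_empty] at hx
      refine ⟨?_, hx.1.1.1⟩
      have := ((addable_iff hn hh hi hl r c).1 hx.1.1).1
      simp only
      omega
    · rw [hcard, Set.ncard_empty]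
      omega
  · set d := Set.ncard {x | Normal h i lam x} - Set.ncard {x | Conormal h i lam x} with hd
    set B := {x | Normal h i lam x ∧ Set.ncard {y | Normal h i lam y ∧ posLE x y} ≤ d} with hB
    have hset : psiSet h i lam = diagram lam \ B := by rw [psiSet, if_neg hc]
    have hcard : B.ncard = d := @rank_ncard _ (@dualLO _ posLO) (fun x y => posLE y x)
      (fun _ _ => Iff.rfl) {x | Normal h i lam x} fn d (by omega)
    obtain ⟨mu, hs, hmu⟩ := remSet hn hh hi hl B (fun x hx => hx.1.1) (by
      rintro r c ⟨h1, h2⟩ h3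
      refine ⟨normal_right hn hh hi hl h1 h3, le_trans (Set.ncard_le_ncard ?_ ?_) h2⟩
      · rintro y ⟨u, v⟩
        refine ⟨u, ?_⟩
        unfold posLE at *
        simp only at *
        omega
      · exact fn.subset fun y hy => hy.1)
    rw [key mu hs (hmu.trans hset.symm)]
    have hsub : B ⊆ diagram lam := fun x hx => hx.1.1.1
    refine ⟨hs, ∅, B, Set.finite_empty, fn.subset fun x hx => hx.1, ?_, ?_, ?_, ?_, ?_⟩
    · simp
    · rw [hmu]; exact Set.disjoint_sdiff_left
    · rw [hmu, Set.union_empty, Set.sdiff_union_of_subset hsub]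
    · rintro ⟨r, c⟩ hx
      rw [Set.empty_union] at hx
      have := ((removable_iff hn hh hi hl r c).1 hx.1.1)
      exact ⟨this.1, this.2.2.1 c le_rfl this.2.1⟩
    · rw [hcard, Set.ncard_empty]
      omega

end BPartition
namespace BPartition

noncomputable def partSum (G : ℕ → ℤ) (lam : BPartition) : ℤ := ((partsM lam).map G).sum

lemma partSum_range (G : ℕ → ℤ) (hG : G 0 = 0) (lam : BPartition) {R : ℕ}
    (hR : ∀ r, R ≤ r → lam.parts r = 0) :
    partSum G lam = ∑ r ∈ Finset.range R, G (lam.parts r) := by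
  have : partSum G lam = ∑ r ∈ lam.parts.support, G (lam.parts r) := by
    unfold partSum partsM
    rw [Multiset.map_map]
    rfl
  rw [this]
  refine Finset.sum_subset (fun r hr => ?_) fun r _ hr => ?_
  · rw [Finset.mem_range]
    by_contra h
    exact (Finsupp.mem_support_iff.1 hr) (hR r (by omega))
  · rw [Finsupp.notMem_support_iff.1 hr, hG]

lemma partSum_cells (G : ℕ → ℤ) (hG : G 0 = 0) (lam : BPartition) :
    partSum G lam = ∑ x ∈ (diagram_finite lam).toFinset, (G x.2 - G (x.2 - 1)) := by
  obtain ⟨R, hR⟩ := exists_bound lam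
  rw [partSum_range G hG lam hR]
  rw [Finset.sum_finset_product _ (Finset.range R) (fun r => Finset.Icc 1 (lam.parts r))]
  · refine Finset.sum_congr rfl fun r _ => ?_
    generalize lam.parts r = l
    induction l with
    | zero => simp [hG]
    | succ k ih => rw [Finset.sum_Icc_succ_top (by omega), ← ih]; simp
  · rintro ⟨r, c⟩
    simp only [Set.Finite.mem_toFinset, mem_diagram, Finset.mem_range, Finset.mem_Icc]
    constructor
    · intro h1
      refine ⟨?_, h1⟩
      by_contra h2
      have := hR r (by omega)
      omega
    · exact fun h1 => h1.2

lemma partSum_diff (G : ℕ → ℤ) (hG : G 0 = 0) (K : ℤ) {lam mu : BPartition} {A B : Set (ℕ × ℕ)}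
    (hA : A.Finite) (hB : B.Finite) (h1 : Disjoint (diagram lam) A) (h2 : Disjoint (diagram mu) B)
    (h3 : diagram lam ∪ A = diagram mu ∪ B) (h4 : ∀ x ∈ A ∪ B, G x.2 - G (x.2 - 1) = K) :
    partSum G mu = partSum G lam + K * ((A.ncard : ℤ) - B.ncard) := by
  classical
  rw [partSum_cells G hG, partSum_cells G hG]
  have a1 : Disjoint (diagram_finite lam).toFinset hA.toFinset := by
    rw [Set.Finite.disjoint_toFinset]; exact h1
  have a2 : Disjoint (diagram_finite mu).toFinset hB.toFinset := by
    rw [Set.Finite.disjoint_toFinset]; exact h2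
  have a3 : (diagram_finite lam).toFinset ∪ hA.toFinset =
      (diagram_finite mu).toFinset ∪ hB.toFinset := by
    apply Finset.coe_injective
    simpa using h3
  have a4 := congrArg (fun s : Finset (ℕ × ℕ) => ∑ x ∈ s, (G x.2 - G (x.2 - 1))) a3
  rw [Finset.sum_union a1, Finset.sum_union a2] at a4
  have a5 : ∑ x ∈ hA.toFinset, (G x.2 - G (x.2 - 1)) = K * A.ncard := by
    rw [Finset.sum_congr rfl (fun x hx => h4 x (Or.inl (hA.mem_toFinset.1 hx))),
      Finset.sum_const, Set.ncard_eq_toFinset_card A hA, nsmul_eq_mul, mul_comm]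
  have a6 : ∑ x ∈ hB.toFinset, (G x.2 - G (x.2 - 1)) = K * B.ncard := by
    rw [Finset.sum_congr rfl (fun x hx => h4 x (Or.inr (hB.mem_toFinset.1 hx))),
      Finset.sum_const, Set.ncard_eq_toFinset_card B hB, nsmul_eq_mul, mul_comm]
  rw [a5, a6] at a4
  rw [mul_sub]
  linarith

/-- the residue-class charge -/
def g (h j l : ℕ) : ℤ :=
  (if l % h = j then 1 else 0) - (if l % h + j = h ∨ l % h + j = 0 then 1 else 0)

lemma g_zero (h j : ℕ) (hj : j < h) : g h j 0 = 0 := by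
  unfold g
  rw [Nat.zero_mod]
  split_ifs <;> omega

lemma g_step {n h i : ℕ} (hn : 1 ≤ n) (hh : h = 2 * n + 1) (hi : i ≤ n) {c : ℕ} (hc : 1 ≤ c)
    (hr : colRes h c = i) (j : ℕ) (hj : j < h) :
    g h j c - g h j (c - 1) = g h j (i + 1) - g h j i := by
  rw [colRes_eq hn hh hi hc] at hr
  obtain ⟨c, rfl⟩ : ∃ d, c = d + 1 := ⟨c - 1, by omega⟩
  rw [Nat.add_sub_cancel]
  unfold g
  rw [Nat.mod_eq_of_lt (show i + 1 < h by omega), Nat.mod_eq_of_lt (show i < h by omega)]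
  rcases mod_succ h c (by omega) with ⟨h1, h2⟩ | ⟨h1, h2⟩ <;> rw [h1] at hr ⊢ <;>
    generalize c % h = a at * <;> clear h1
  · obtain rfl : i = 0 := by omega
    split_ifs <;> omega
  · rcases hr with hr | hr | hr
    · obtain rfl : a = i := by omega
      rfl
    · split_ifs <;> omega
    · omega

section
open Classical

noncomputable def ind (p : Prop) : ℤ := if p then 1 else 0

lemma ind_true {p : Prop} (hp : p) : ind p = 1 := if_pos hp
lemma ind_false {p : Prop} (hp : ¬ p) : ind p = 0 := if_neg hp

noncomputable def FF (h i v : ℕ) : ℤ :=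
  ind (colRes h (v + 1) = i) + ind (colRes h (v + 1) = i ∧ colRes h (v + 2) = i)

noncomputable def GG (h i u : ℕ) : ℤ :=
  if u = 0 then ind (i = 0) else
  ind (colRes h u = i) + ind (colRes h u = i ∧ colRes h (u - 1) = i)

noncomputable def aI (h i v u : ℕ) : ℤ :=
  ind (colRes h (v + 1) = i ∧ okP h (v + 1) u) +
    ind (colRes h (v + 1) = i ∧ colRes h (v + 2) = i ∧ okP h (v + 2) u)

noncomputable def bI (h i v u : ℕ) : ℤ :=
  ind (1 ≤ u ∧ colRes h u = i ∧ okP h v (u - 1)) +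
    ind (2 ≤ u ∧ colRes h u = i ∧ colRes h (u - 1) = i ∧ okP h v (u - 2))

lemma colRes_eq' {n h i c : ℕ} (hn : 1 ≤ n) (hh : h = 2 * n + 1) (hi : i ≤ n) :
    colRes h c = i ↔ c % h = i + 1 ∨ c % h + i = h ∨ (c % h = 0 ∧ i = 0) := by
  rcases Nat.eq_zero_or_pos c with rfl | hc
  · rw [Nat.zero_mod]
    simp [colRes]
    omega
  · exact colRes_eq hn hh hi hc

lemma FF_eq {n h i : ℕ} (hn : 1 ≤ n) (hh : h = 2 * n + 1) (hi : i ≤ n) (v : ℕ) :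
    FF h i v = if i = 0 then (if v % h + 1 = h then 2 else if v % h = 0 then 1 else 0) else
      if v % h = i ∨ v % h + i + 1 = h then 1 else 0 := by
  unfold FF ind
  simp only [colRes_eq' hn hh hi]
  have h1 := mod_succ h v (by omega)
  have h2 := mod_succ h (v + 1) (by omega)
  rw [show v + 1 + 1 = v + 2 from rfl] at h2
  generalize v % h = a at *
  generalize (v + 1) % h = b at *
  generalize (v + 2) % h = c at *
  split_ifs <;> omega

lemma GG_eq {n h i : ℕ} (hn : 1 ≤ n) (hh : h = 2 * n + 1) (hi : i ≤ n) (v : ℕ) :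
    GG h i v = if i = 0 then (if v % h = 1 then 2 else if v % h = 0 then 1 else 0) else
      if v % h = i + 1 ∨ v % h + i = h then 1 else 0 := by
  unfold GG ind
  rcases Nat.eq_zero_or_pos v with rfl | hv
  · rw [Nat.zero_mod]
    simp only [if_true]
    split_ifs <;> first | omega | rfl | (simp_all; done) | (simp_all <;> omega)
  obtain ⟨v, rfl⟩ : ∃ d, v = d + 1 := ⟨v - 1, by omega⟩
  rw [Nat.add_sub_cancel, if_neg (by omega)]
  simp only [colRes_eq' hn hh hi]
  have h1 := mod_succ h v (by omega)
  generalize v % h = a at *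
  generalize (v + 1) % h = b at *
  split_ifs <;> omega

def ee (n i : ℕ) : ℤ := if i = 0 then 4 else if i = n then 1 else 2

lemma FG {n h i : ℕ} (hn : 1 ≤ n) (hh : h = 2 * n + 1) (hi : i ≤ n) (v : ℕ) :
    2 * (FF h i v - GG h i v) = ee n i * (g h i v - g h (i + 1) v) := by
  rw [FF_eq hn hh hi, GG_eq hn hh hi]
  unfold g ee
  have := Nat.mod_lt v (show 0 < h by omega)
  generalize v % h = a at *
  by_cases h1 : i = 0
  · simp only [h1, if_true]
    split_ifs <;> first | omega | rfl | (simp_all; done) | (simp_all <;> omega)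
  · simp only [h1, if_false]
    by_cases h2 : i = n
    · simp only [h2, if_true]
      split_ifs <;> first | omega | rfl | (simp_all; done) | (simp_all <;> omega)
    · simp only [h2, if_false]
      split_ifs <;> first | omega | rfl | (simp_all; done) | (simp_all <;> omega)

lemma ind_add_congr {p q p' q' : Prop} (h1 : p ↔ p') (h2 : q ↔ q') :
    ind p + ind q = ind p' + ind q' := by
  rw [show p = p' from propext h1, show q = q' from propext h2]

lemma row_id {n h i : ℕ} (hn : 1 ≤ n) (hh : h = 2 * n + 1) (hi : i ≤ n) {v u : ℕ}
    (ok : okP h v u) : aI h i v u + GG h i u = bI h i v u + FF h i v := by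
  rcases Nat.eq_zero_or_pos u with rfl | hu
  · obtain rfl : v = 0 := by unfold okP at ok; omega
    rw [FF_eq hn hh hi, GG_eq hn hh hi]
    unfold aI bI
    rw [ind_false, ind_false, ind_false, ind_false, Nat.zero_mod]
    · split_ifs <;> first | omega | rfl | (simp_all; done) | (simp_all <;> omega)
    all_goals unfold okP; omega
  have hv : v ≤ u := by unfold okP at ok; omega
  unfold aI bI GG FF
  rw [if_neg (by omega)]
  rcases (show u = v ∨ u = v + 1 ∨ u = v + 2 ∨ v + 3 ≤ u by omega) with rfl | rfl | rfl | h3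
  · have h0 : u % h = 0 := by unfold okP at ok; omega
    have h1 : GG h i u = FF h i u := by
      rw [FF_eq hn hh hi, GG_eq hn hh hi, h0]; split_ifs <;> first | omega | rfl | (simp_all; done) | (simp_all <;> omega)
    unfold GG FF at h1
    rw [if_neg (by omega)] at h1
    rw [ind_false (p := _ ∧ okP h (u + 1) u), ind_false (p := _ ∧ _ ∧ okP h (u + 2) u),
      ind_false (p := _ ∧ _ ∧ okP h u (u - 1)), ind_false (p := _ ∧ _ ∧ _ ∧ okP h u (u - 2)), h1]
    all_goals unfold okP; omega
  · have h1 := mod_succ h v (by omega)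
    have h2 := mod_succ h (v + 1) (by omega)
    rw [show v + 1 + 1 = v + 2 from rfl] at h2
    rw [Nat.add_sub_cancel, ind_false (p := _ ∧ _ ∧ okP h (v + 2) (v + 1)),
      ind_false (p := _ ∧ _ ∧ _ ∧ okP h v (v + 1 - 2))]
    · have e1 : okP h (v + 1) (v + 1) ↔ (v + 1) % h = 0 := by unfold okP; omega
      have e2 : okP h v v ↔ v % h = 0 := by unfold okP; omega
      rw [e1, e2]
      simp only [colRes_eq' hn hh hi]
      generalize v % h = a at *
      generalize (v + 1) % h = b at *
      generalize (v + 2) % h = c at *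
      unfold ind
      clear e1 e2 ok
      split_ifs <;> omega
    all_goals unfold okP; omega
  · have h1 := mod_succ h v (by omega)
    have h2 := mod_succ h (v + 1) (by omega)
    rw [show v + 1 + 1 = v + 2 from rfl] at h2
    have e1 : okP h (v + 2) (v + 2) ↔ (v + 2) % h = 0 := by unfold okP; omega
    have e2 : okP h v v ↔ v % h = 0 := by unfold okP; omega
    have e3 : okP h (v + 1) (v + 2) ↔ True := iff_true_intro (Or.inl (by omega))
    have e4 : okP h v (v + 1) ↔ True := iff_true_intro (Or.inl (by omega))
    rw [show v + 2 - 1 = v + 1 from rfl, show v + 2 - 2 = v from rfl, e1, e2, e3, e4]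
    have d1 : ¬ (colRes h (v + 1) = i ∧ colRes h (v + 2) = i ∧ (v + 2) % h = 0) := by
      simp only [colRes_eq' hn hh hi]; omega
    have d2 : ¬ (2 ≤ v + 2 ∧ colRes h (v + 2) = i ∧ colRes h (v + 1) = i ∧ v % h = 0) := by
      simp only [colRes_eq' hn hh hi]; omega
    rw [ind_false d1, ind_false d2]
    simp only [and_true]
    unfold ind
    split_ifs <;> omega
  · have e1 : okP h (v + 2) u ↔ True := iff_true_intro (Or.inl (by omega))
    have e2 : okP h v (u - 1) ↔ True := iff_true_intro (Or.inl (by omega))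
    have e3 : okP h (v + 1) u ↔ True := iff_true_intro (Or.inl (by omega))
    have e4 : okP h v (u - 2) ↔ True := iff_true_intro (Or.inl (by omega))
    rw [e1, e2, e3, e4]
    simp only [and_true, show 1 ≤ u by omega, show 2 ≤ u by omega, true_and]
    ring

lemma add_count {n h i : ℕ} (hn : 1 ≤ n) (hh : h = 2 * n + 1) (hi : i ≤ n) {lam : BPartition}
    (hl : IsHStrict h lam) {R : ℕ} (hR : ∀ r, R ≤ r → lam.parts r = 0) :
    (Set.ncard {x | Addable h i lam x} : ℤ) =
      FF h i (lam.parts 0) + ∑ r ∈ Finset.range R, aI h i (lam.parts (r + 1)) (lam.parts r) := by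
  rw [Set.ncard_eq_toFinset_card _ (add_finite hn hh hi hl), Finset.card_eq_sum_ones]
  push_cast
  rw [Finset.sum_finset_product _ (Finset.range (R + 1))
    (fun r => ({lam.parts r + 1, lam.parts r + 2} : Finset ℕ).filter
      fun c => Addable h i lam (r, c))]
  · have e : ∀ r, ∑ c ∈ ({lam.parts r + 1, lam.parts r + 2} : Finset ℕ).filter
      (fun c => Addable h i lam (r, c)), (1 : ℤ) =
        ind (Addable h i lam (r, lam.parts r + 1)) + ind (Addable h i lam (r, lam.parts r + 2)) := by
      intro r
      rw [Finset.sum_filter, Finset.sum_pair (by omega)]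
      rfl
    have cc : ∀ l c', l < c' → c' ≤ l + 2 → c' = l + 1 ∨ c' = l + 2 := by intros; omega
    simp only [e]
    rw [Finset.sum_range_succ', add_comm]
    congr 1
    · unfold FF
      apply ind_add_congr
      · rw [addable_iff hn hh hi hl]
        constructor
        · exact fun H => H.2.1 _ (by omega) (by omega)
        · intro H
          refine ⟨by omega, fun c' a b => ?_, fun s hs => by omega⟩
          rw [show c' = lam.parts 0 + 1 by omega]; exact H
      · rw [addable_iff hn hh hi hl]
        constructor
        · exact fun H => ⟨H.2.1 _ (by omega) (by omega), H.2.1 _ (by omega) (by omega)⟩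
        · intro H
          refine ⟨by omega, fun c' a b => ?_, fun s hs => by omega⟩
          rcases cc _ _ a b with h5 | h5
          · rw [h5]; exact H.1
          · rw [h5]; exact H.2
    · refine Finset.sum_congr rfl fun r _ => ?_
      unfold aI
      apply ind_add_congr
      · rw [addable_iff hn hh hi hl]
        constructor
        · exact fun H => ⟨H.2.1 _ (by omega) (by omega), H.2.2 r rfl⟩
        · intro H
          refine ⟨by omega, fun c' a b => ?_, fun s hs => ?_⟩
          · rw [show c' = lam.parts (r + 1) + 1 by omega]; exact H.1
          · rw [show s = r by omega]; exact H.2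
      · rw [addable_iff hn hh hi hl]
        constructor
        · exact fun H => ⟨H.2.1 _ (by omega) (by omega), H.2.1 _ (by omega) (by omega),
            H.2.2 r rfl⟩
        · intro H
          refine ⟨by omega, fun c' a b => ?_, fun s hs => ?_⟩
          · rcases cc _ _ a b with h5 | h5
            · rw [h5]; exact H.1
            · rw [h5]; exact H.2.1
          · rw [show s = r by omega]; exact H.2.2
  · rintro ⟨r, c⟩
    simp only [Set.Finite.mem_toFinset, Set.mem_ofPred_eq, Finset.mem_range, Finset.mem_filter,
      Finset.mem_insert, Finset.mem_singleton]
    constructor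
    · intro H
      have h1 := add_row_le hn hh hi hl hR H
      have h2 := (addable_iff hn hh hi hl r c).1 H
      have h3 := add_col_le hn hh hi h2.2.1
      exact ⟨by omega, by omega, H⟩
    · exact fun H => H.2.2

lemma rem_count {n h i : ℕ} (hn : 1 ≤ n) (hh : h = 2 * n + 1) (hi : i ≤ n) {lam : BPartition}
    (hl : IsHStrict h lam) {R : ℕ} (hR : ∀ r, R ≤ r → lam.parts r = 0) :
    (Set.ncard {x | Removable h i lam x} : ℤ) =
      ∑ r ∈ Finset.range R, bI h i (lam.parts (r + 1)) (lam.parts r) := by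
  rw [Set.ncard_eq_toFinset_card _ rem_finite, Finset.card_eq_sum_ones]
  push_cast
  rw [Finset.sum_finset_product _ (Finset.range R)
    (fun r => ({lam.parts r, lam.parts r - 1} : Finset ℕ).filter
      fun c => Removable h i lam (r, c))]
  · refine Finset.sum_congr rfl fun r _ => ?_
    have e : ∑ c ∈ ({lam.parts r, lam.parts r - 1} : Finset ℕ).filter
      (fun c => Removable h i lam (r, c)), (1 : ℤ) =
        ind (Removable h i lam (r, lam.parts r)) +
          ind (Removable h i lam (r, lam.parts r - 1)) := by
      rcases Nat.eq_zero_or_pos (lam.parts r) with h0 | h0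
      · have : ∀ c, c ≤ 0 → ¬ Removable h i lam (r, c) := by
          intro c hc H
          have := ((removable_iff hn hh hi hl _ _).1 H).1
          omega
        rw [ind_false (this _ (by omega)), ind_false (this _ (by omega))]
        rw [Finset.filter_false_of_mem]
        · simp
        · intro c hc
          refine this c ?_
          simp [h0] at hc
          omega
      · rw [Finset.sum_filter, Finset.sum_pair (by omega)]
        rfl
    rw [e]
    unfold bI
    apply ind_add_congr
    · rw [removable_iff hn hh hi hl]
      constructor
      · exact fun H => ⟨H.1, H.2.2.1 _ le_rfl le_rfl, H.2.2.2⟩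
      · intro H
        refine ⟨H.1, le_rfl, fun c' a b => ?_, H.2.2⟩
        rw [show c' = lam.parts r by omega]; exact H.2.1
    · rw [removable_iff hn hh hi hl, Nat.sub_sub]
      constructor
      · exact fun H => ⟨by omega, H.2.2.1 _ (by omega) le_rfl, H.2.2.1 _ le_rfl (by omega),
          H.2.2.2⟩
      · intro H
        refine ⟨by omega, by omega, fun c' a b => ?_, H.2.2.2⟩
        rcases (show c' = lam.parts r ∨ c' = lam.parts r - 1 by omega) with h5 | h5
        · rw [h5]; exact H.2.1
        · rw [h5]; exact H.2.2.1
  · rintro ⟨r, c⟩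
    simp only [Set.Finite.mem_toFinset, Set.mem_ofPred_eq, Finset.mem_range, Finset.mem_filter,
      Finset.mem_insert, Finset.mem_singleton]
    constructor
    · intro H
      have h2 := (removable_iff hn hh hi hl r c).1 H
      have h3 := rem_col_ge hn hh hi h2.1 h2.2.2.1
      refine ⟨?_, by omega, H⟩
      by_contra h4
      have := hR r (by omega)
      omega
    · exact fun H => H.2.2

lemma D_formula {n h i : ℕ} (hn : 1 ≤ n) (hh : h = 2 * n + 1) (hi : i ≤ n) {lam : BPartition}
    (hl : IsHStrict h lam) :
    2 * ((Set.ncard {x | Addable h i lam x} : ℤ) - Set.ncard {x | Removable h i lam x}) =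
      ee n i * (partSum (g h i) lam - partSum (g h (i + 1)) lam) + (if i = 0 then 2 else 0) := by
  obtain ⟨R, hR⟩ := exists_bound lam
  have hl' := (hstrict_iff h lam).1 hl
  rw [add_count hn hh hi hl hR, rem_count hn hh hi hl hR,
    partSum_range _ (g_zero h _ (by omega)) lam hR, partSum_range _ (g_zero h _ (by omega)) lam hR]
  have h1 : ∑ r ∈ Finset.range R, aI h i (lam.parts (r + 1)) (lam.parts r) +
      ∑ r ∈ Finset.range R, GG h i (lam.parts r) =
      ∑ r ∈ Finset.range R, bI h i (lam.parts (r + 1)) (lam.parts r) +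
      ∑ r ∈ Finset.range R, FF h i (lam.parts (r + 1)) := by
    rw [← Finset.sum_add_distrib, ← Finset.sum_add_distrib]
    exact Finset.sum_congr rfl fun r _ => row_id hn hh hi (hl' r)
  have h2 := Finset.sum_range_succ (fun r => FF h i (lam.parts r)) R
  have h3 := Finset.sum_range_succ' (fun r => FF h i (lam.parts r)) R
  have h4 : 2 * (∑ r ∈ Finset.range R, FF h i (lam.parts r) -
      ∑ r ∈ Finset.range R, GG h i (lam.parts r)) = ee n i *
      (∑ r ∈ Finset.range R, g h i (lam.parts r) -
        ∑ r ∈ Finset.range R, g h (i + 1) (lam.parts r)) := by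
    rw [← Finset.sum_sub_distrib, ← Finset.sum_sub_distrib, Finset.mul_sum, Finset.mul_sum]
    exact Finset.sum_congr rfl fun r _ => FG hn hh hi _
  have h5 : 2 * FF h i (lam.parts R) = if i = 0 then 2 else 0 := by
    rw [hR R le_rfl, FF_eq hn hh hi, Nat.zero_mod]
    split_ifs <;> omega
  linarith

end

/-- Numerical effect of `psi`. -/
lemma psi_num {n h i : ℕ} (hn : 1 ≤ n) (hh : h = 2 * n + 1) (hi : i ≤ n) {lam : BPartition}
    (hl : IsHStrict h lam) :
    IsHStrict h (psi h i lam) ∧ ∃ d : ℤ,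
      2 * d = ee n i * (partSum (g h i) lam - partSum (g h (i + 1)) lam) +
        (if i = 0 then 2 else 0) ∧
      partSum (fun l => (l : ℤ)) (psi h i lam) = partSum (fun l => (l : ℤ)) lam + d ∧
      ∀ j < h, partSum (g h j) (psi h i lam) =
        partSum (g h j) lam + (g h j (i + 1) - g h j i) * d := by
  obtain ⟨h1, A, B, hA, hB, h2, h3, h4, h5, h6⟩ := psi_spec hn hh hi hl
  refine ⟨h1, (A.ncard : ℤ) - B.ncard, ?_, ?_, ?_⟩
  · rw [h6, D_formula hn hh hi hl]
  · have := partSum_diff (fun l => (l : ℤ)) (by simp) 1 hA hB h2 h3 h4 (by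
      intro x hx
      have := (h5 x hx).1
      push_cast [this]
      ring)
    linarith
  · intro j hj
    exact partSum_diff (g h j) (g_zero h j hj) _ hA hB h2 h3 h4 fun x hx =>
      g_step hn hh hi (h5 x hx).1 (h5 x hx).2 j hj

end BPartition
namespace BPartition

lemma pos_of_mem {lam : BPartition} {x : ℕ} (hx : x ∈ partsM lam) : 0 < x := by
  unfold partsM at hx
  obtain ⟨r, hr, rfl⟩ := Multiset.mem_map.1 hx
  exact Nat.pos_of_ne_zero (Finsupp.mem_support_iff.1 hr)

lemma le_parts_iff (lam : BPartition) {c : ℕ} (hc : 1 ≤ c) (r : ℕ) :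
    c ≤ lam.parts r ↔ r < Multiset.card ((partsM lam).filter (fun x => c ≤ x)) := by
  have e : Multiset.card ((partsM lam).filter (fun x => c ≤ x)) =
      (lam.parts.support.filter (fun r => c ≤ lam.parts r)).card := by
    unfold partsM
    rw [Multiset.filter_map, Multiset.card_map]
    rfl
  have ha : Antitone lam.parts := antitone_nat_of_succ_le lam.antitone
  rw [e]
  constructor
  · intro h1
    have : Finset.range (r + 1) ⊆ lam.parts.support.filter (fun r => c ≤ lam.parts r) := by
      intro s hs
      have hs := Finset.mem_range.1 hs
      have := ha (show s ≤ r by omega)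
      rw [Finset.mem_filter, Finsupp.mem_support_iff]
      omega
    have := Finset.card_le_card this
    rw [Finset.card_range] at this
    omega
  · intro h1
    by_contra h2
    have : lam.parts.support.filter (fun r => c ≤ lam.parts r) ⊆ Finset.range r := by
      intro s hs
      rw [Finset.mem_filter] at hs
      rw [Finset.mem_range]
      by_contra h3
      have := ha (show r ≤ s by omega)
      omega
    have := Finset.card_le_card this
    rw [Finset.card_range] at this
    omega

lemma partsM_inj {lam mu : BPartition} (h : partsM lam = partsM mu) : lam = mu := by
  apply ext_parts
  intro r
  have key : ∀ c, 1 ≤ c → (c ≤ lam.parts r ↔ c ≤ mu.parts r) := by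
    intro c hc
    rw [le_parts_iff lam hc, le_parts_iff mu hc, h]
  rcases Nat.eq_zero_or_pos (lam.parts r) with h1 | h1
  · rcases Nat.eq_zero_or_pos (mu.parts r) with h2 | h2
    · omega
    · have := (key _ h2).2 le_rfl
      omega
  · have a := (key _ h1).1 le_rfl
    have b := (key _ (show 1 ≤ mu.parts r by omega)).2 le_rfl
    omega

lemma count_le_one {h : ℕ} {lam : BPartition} (hl : IsHStrict h lam) {x : ℕ} (hx : ¬ h ∣ x) :
    (partsM lam).count x ≤ 1 := by
  unfold partsM
  rw [Multiset.count_map]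
  have ha : Antitone lam.parts := antitone_nat_of_succ_le lam.antitone
  have hl' := (hstrict_iff h lam).1 hl
  have key : ∀ r s, r < s → x = lam.parts r → x = lam.parts s → False := by
    intro r s hrs h1 h2
    have h3 := ha (show r + 1 ≤ s by omega)
    have h4 := hl' r
    unfold okP at h4
    rcases h4 with h4 | h4
    · omega
    · exact hx (Nat.dvd_of_mod_eq_zero (by rw [h1]; exact h4.2))
  have : Multiset.card (Multiset.filter (fun a => x = lam.parts a) lam.parts.support.val) =
      (lam.parts.support.filter (fun a => x = lam.parts a)).card := rfl
  rw [this, Finset.card_le_one]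
  intro r hr s hs
  rw [Finset.mem_filter] at hr hs
  by_contra h1
  rcases Nat.lt_or_gt_of_ne h1 with h2 | h2
  · exact key r s h2 hr.2 hs.2
  · exact key s r h2 hs.2 hr.2

lemma exists_of_multiset {h : ℕ} (hh : 1 ≤ h) (s : Multiset ℕ) (h0 : 0 ∉ s)
    (hc : ∀ x, ¬ h ∣ x → s.count x ≤ 1) : ∃ lam, IsHStrict h lam ∧ partsM lam = s := by
  obtain ⟨l, rfl, hs⟩ : ∃ l : List ℕ, (l : Multiset ℕ) = s ∧ l.Pairwise (· ≥ ·) :=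
    ⟨s.sort (· ≥ ·), Multiset.sort_eq _ _, Multiset.pairwise_sort _ _⟩
  have hget : ∀ r (hr : r < l.length), l.getD r 0 = l[r] := fun r hr => by
    simp [List.getD_eq_getElem?_getD, hr]
  have hge : ∀ r, l.length ≤ r → l.getD r 0 = 0 := fun r hr => by
    simp [List.getD_eq_getElem?_getD, hr]
  have hpos : ∀ r (hr : r < l.length), l[r] ≠ 0 := fun r hr h1 =>
    h0 (by rw [← h1]; exact Multiset.mem_coe.2 (List.getElem_mem hr))
  obtain ⟨mu, hmu, hst⟩ := mkP h (fun r => l.getD r 0) l.length hge (by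
    intro r
    show okP h (l.getD (r + 1) 0) (l.getD r 0)
    by_cases h1 : r + 1 < l.length
    · rw [hget _ h1, hget _ (by omega)]
      have h2 := List.pairwise_iff_getElem.1 hs r (r + 1) (by omega) h1 (by omega)
      unfold okP
      rcases Nat.lt_or_ge l[r + 1] l[r] with h3 | h3
      · exact Or.inl h3
      · have h4 : l[r + 1] = l[r] := le_antisymm h2 h3
        refine Or.inr ⟨h4, ?_⟩
        by_contra h5
        have h6 := hc l[r] (fun h7 => h5 (Nat.mod_eq_zero_of_dvd h7))
        rw [Multiset.coe_count] at h6
        have h8 : ¬ (2 ≤ l.count l[r]) := by omega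
        apply h8
        rw [← List.duplicate_iff_two_le_count]
        rw [List.duplicate_iff_exists_distinct_get]
        exact ⟨⟨r, by omega⟩, ⟨r + 1, h1⟩, by simp, by simp, by simp [h4]⟩
    · rw [hge (r + 1) (by omega)]
      unfold okP
      rcases Nat.eq_zero_or_pos (l.getD r 0) with h2 | h2
      · rw [h2]; right; simp
      · left; exact h2)
  refine ⟨mu, hst, ?_⟩
  have hsup : mu.parts.support = Finset.range l.length := by
    ext r
    rw [Finsupp.mem_support_iff, Finset.mem_range, hmu]
    constructor
    · intro h1
      by_contra h2
      exact h1 (hge r (by omega))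
    · intro h1
      rw [hget r h1]
      exact hpos r h1
  unfold partsM
  rw [hsup]
  simp only [hmu]
  show ((List.map (fun r => l.getD r 0) (List.range l.length) : List ℕ) : Multiset ℕ) = l
  congr 1
  apply List.ext_getElem
  · simp
  · intro r h1 h2
    rw [List.getElem_map, List.getElem_range, hget r h2]

lemma barStep_sum {h : ℕ} (G : ℕ → ℤ) (K : ℤ) (h1 : G h = K)
    (h2 : ∀ v, h < v → G v = G (v - h) + K)
    (h3 : ∀ a b, a + b = h → 0 < a → 0 < b → G a + G b = K) {lam mu : BPartition}
    (hs : barStep h lam mu) : partSum G lam = partSum G mu + K := by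
  obtain ⟨v, -, hs⟩ := hs
  unfold partSum
  have er : ∀ (s : Multiset ℕ) x, x ∈ s → (s.map G).sum = G x + ((s.erase x).map G).sum := by
    intro s x hx
    conv_lhs => rw [← Multiset.cons_erase hx]
    rw [Multiset.map_cons, Multiset.sum_cons]
  rcases hs with ⟨rfl, hv, hm⟩ | ⟨hlt, hv, hm⟩ | ⟨a, b, hab, ha, hb, -, hm⟩
  · rw [er _ _ hv, hm, h1]; ring
  · rw [er _ _ hv, hm, Multiset.map_cons, Multiset.sum_cons, h2 v hlt]; ring
  · have := h3 a b hab (pos_of_mem ha) (pos_of_mem (Multiset.mem_of_mem_erase hb))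
    rw [er _ _ ha, er _ _ hb, hm]; linarith

lemma barChain_sum {h : ℕ} (G : ℕ → ℤ) (K : ℤ) (h1 : G h = K)
    (h2 : ∀ v, h < v → G v = G (v - h) + K)
    (h3 : ∀ a b, a + b = h → 0 < a → 0 < b → G a + G b = K) (w : ℕ) : ∀ {lam mu : BPartition}
    (_ : barChain h w lam mu), partSum G lam = partSum G mu + K * w := by
  induction w with
  | zero => rintro lam mu rfl; simp
  | succ w ih =>
    rintro lam mu ⟨nu, a, b⟩
    rw [barStep_sum G K h1 h2 h3 a, ih b]
    push_cast
    ring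

lemma chain_size {h w : ℕ} {lam mu : BPartition} (hc : barChain h w lam mu) :
    partSum (fun l => (l : ℤ)) lam = partSum (fun l => (l : ℤ)) mu + h * w :=
  barChain_sum _ _ rfl (fun v hv => by push_cast [hv.le]; ring)
    (fun a b hab _ _ => by push_cast [← hab]; ring) w hc

lemma chain_g {h w : ℕ} {lam mu : BPartition} (hc : barChain h w lam mu) {j : ℕ} (hj : j < h) :
    partSum (g h j) lam = partSum (g h j) mu := by
  rw [barChain_sum (g h j) 0 ?_ ?_ ?_ w hc]
  · ring
  · have := g_zero h j hj
    unfold g at *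
    rw [Nat.mod_self]
    rwa [Nat.zero_mod] at this
  · intro v hv
    unfold g
    rw [← Nat.mod_eq_sub_mod hv.le]
    ring
  · intro a b hab ha hb
    unfold g
    rw [Nat.mod_eq_of_lt (show a < h by omega), Nat.mod_eq_of_lt (show b < h by omega)]
    split_ifs <;> omega

lemma size_nonneg (lam : BPartition) : 0 ≤ partSum (fun l => (l : ℤ)) lam := by
  unfold partSum
  apply Multiset.sum_nonneg
  intro x hx
  obtain ⟨a, -, rfl⟩ := Multiset.mem_map.1 hx
  positivity

lemma core_exists {h : ℕ} (hh : 1 ≤ h) (N : ℕ) : ∀ lam : BPartition, IsHStrict h lam →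
    partSum (fun l => (l : ℤ)) lam < N → ∃ w tau, IsBarCore h tau ∧ barChain h w lam tau := by
  induction N with
  | zero =>
    intro lam _ h1
    have := size_nonneg lam
    push_cast at h1
    omega
  | succ N ih =>
    intro lam hl h1
    by_cases hc : IsBarCore h lam
    · exact ⟨0, lam, hc, rfl⟩
    · have : ∃ mu, barStep h lam mu := by
        by_contra h2
        exact hc ⟨hl, fun mu hmu => h2 ⟨mu, hmu⟩⟩
      obtain ⟨mu, hmu⟩ := this
      have h3 := chain_size (show barChain h 1 lam mu from ⟨mu, hmu, rfl⟩)
      push_cast at h1 h3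
      have hmu2 := hmu
      obtain ⟨v, h4, -⟩ := hmu2
      obtain ⟨w, tau, a, b⟩ := ih mu h4 (by omega)
      exact ⟨w + 1, tau, a, mu, hmu, b⟩

lemma core_dvd {h : ℕ} (hh : 1 ≤ h) {s : BPartition} (hs : IsBarCore h s) {x : ℕ}
    (hx : x ∈ partsM s) : ¬ h ∣ x := by
  intro hd
  have hp := pos_of_mem hx
  have hle := Nat.le_of_dvd hp hd
  have hz : 0 ∉ (partsM s).erase x := fun h1 =>
    absurd (pos_of_mem (Multiset.mem_of_mem_erase h1)) (by omega)
  have hcnt : ∀ y, ¬ h ∣ y → ((partsM s).erase x).count y ≤ 1 := fun y hy =>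
    (Multiset.count_le_of_le y (Multiset.erase_le x _)).trans (count_le_one hs.1 hy)
  rcases hle.eq_or_lt with h1 | h1
  · obtain ⟨mu, h2, h3⟩ := exists_of_multiset hh _ hz hcnt
    exact hs.2 mu ⟨x, h2, Or.inl ⟨h1.symm, hx, h3⟩⟩
  · obtain ⟨mu, h2, h3⟩ := exists_of_multiset hh ((x - h) ::ₘ (partsM s).erase x)
      (by rw [Multiset.mem_cons]; rintro (h4 | h4); · omega
          · exact hz h4)
      (by
        intro y hy
        rw [Multiset.count_cons_of_ne]
        · exact hcnt y hy
        · rintro rfl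
          exact hy (Nat.dvd_sub hd dvd_rfl))
    exact hs.2 mu ⟨x, h2, Or.inr (Or.inl ⟨h1, hx, h3⟩)⟩

lemma core_down {h : ℕ} (hh : 1 ≤ h) {s : BPartition} (hs : IsBarCore h s) {x : ℕ}
    (hx : x ∈ partsM s) (hlt : h < x) : x - h ∈ partsM s := by
  by_contra hno
  have hp := pos_of_mem hx
  have hz : 0 ∉ (partsM s).erase x := fun h1 =>
    absurd (pos_of_mem (Multiset.mem_of_mem_erase h1)) (by omega)
  have hcnt : ∀ y, ¬ h ∣ y → ((partsM s).erase x).count y ≤ 1 := fun y hy =>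
    (Multiset.count_le_of_le y (Multiset.erase_le x _)).trans (count_le_one hs.1 hy)
  obtain ⟨mu, h2, h3⟩ := exists_of_multiset hh ((x - h) ::ₘ (partsM s).erase x)
      (by rw [Multiset.mem_cons]; rintro (h4 | h4); · omega
          · exact hz h4)
      (by
        intro y hy
        by_cases h5 : y = x - h
        · rw [h5, Multiset.count_cons_self, Multiset.count_eq_zero_of_notMem]
          exact fun h6 => hno (Multiset.mem_of_mem_erase h6)
        · rw [Multiset.count_cons_of_ne h5]
          exact hcnt y hy)
  exact hs.2 mu ⟨x, h2, Or.inr (Or.inl ⟨hlt, hx, h3⟩)⟩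

lemma core_pair {h : ℕ} (hh : h % 2 = 1) {s : BPartition} (hs : IsBarCore h s) {a b : ℕ}
    (hab : a + b = h) (ha : a ∈ partsM s) (hb : b ∈ partsM s) : False := by
  have hb' : b ∈ (partsM s).erase a := (Multiset.mem_erase_of_ne (by omega)).2 hb
  have hle : ((partsM s).erase a).erase b ≤ partsM s :=
    (Multiset.erase_le b _).trans (Multiset.erase_le a _)
  obtain ⟨mu, h2, h3⟩ := exists_of_multiset (show 1 ≤ h by omega) (((partsM s).erase a).erase b)
    (fun h1 => absurd (pos_of_mem (Multiset.mem_of_le hle h1)) (by omega))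
    (fun y hy => (Multiset.count_le_of_le y hle).trans (count_le_one hs.1 hy))
  exact hs.2 mu ⟨max a b, h2, Or.inr (Or.inr ⟨a, b, hab, ha, hb', rfl, h3⟩)⟩

lemma core_nodup {h : ℕ} (hh : 1 ≤ h) {s : BPartition} (hs : IsBarCore h s) :
    (partsM s).Nodup := by
  rw [Multiset.nodup_iff_count_le_one]
  intro x
  by_cases hx : x ∈ partsM s
  · exact count_le_one hs.1 (core_dvd hh hs hx)
  · rw [Multiset.count_eq_zero_of_notMem hx]; omega

lemma core_descend {h : ℕ} (hh : 1 ≤ h) {s : BPartition} (hs : IsBarCore h s) {j k : ℕ}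
    (hj : 0 < j) (m : ℕ) : (k + m) * h + j ∈ partsM s → k * h + j ∈ partsM s := by
  induction m with
  | zero => exact id
  | succ m ih =>
    intro h1
    apply ih
    have e : (k + (m + 1)) * h + j = (k + m) * h + j + h := by ring
    rw [e] at h1
    have := core_down hh hs h1 (by omega)
    rwa [Nat.add_sub_cancel] at this

lemma core_mem {h : ℕ} (hh : h % 2 = 1) {s : BPartition} (hs : IsBarCore h s) {x : ℕ}
    (hx : x % h ≠ 0) : x ∈ partsM s ↔ ((x / h : ℕ) : ℤ) < partSum (g h (x % h)) s := by
  have hh1 : 1 ≤ h := by omega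
  have hnd := core_nodup hh1 hs
  have hjlt := Nat.mod_lt x (show 0 < h by omega)
  have hdiv := Nat.div_add_mod' x h
  set j := x % h with hj
  set q := x / h with hq
  have e : partSum (g h j) s =
      (((partsM s).toFinset.filter (fun y => y % h = j)).card : ℤ) -
      ((partsM s).toFinset.filter (fun y => y % h + j = h ∨ y % h + j = 0)).card := by
    have : partSum (g h j) s = ∑ y ∈ (partsM s).toFinset, g h j y := by
      show _ = (((partsM s).toFinset.val).map (g h j)).sum
      rw [Multiset.toFinset_val, hnd.dedup]
      rfl
    rw [this]
    unfold g
    rw [Finset.sum_sub_distrib, Finset.sum_boole, Finset.sum_boole]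
  have desc : ∀ y ∈ partsM s, y % h ≠ 0 → ∀ k, k ≤ y / h → k * h + y % h ∈ partsM s := by
    intro y hy h0 k hk
    apply core_descend hh1 hs (by omega) (y / h - k)
    rw [show k + (y / h - k) = y / h by omega, Nat.div_add_mod']
    exact hy
  constructor
  · intro hxm
    have c2 : (partsM s).toFinset.filter (fun y => y % h + j = h ∨ y % h + j = 0) = ∅ := by
      apply Finset.filter_eq_empty_iff.2
      intro y hy h1
      have hy := Multiset.mem_toFinset.1 hy
      have a1 := desc x hxm hx 0 (Nat.zero_le _)
      have a2 := desc y hy (by omega) 0 (Nat.zero_le _)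
      rw [Nat.zero_mul, Nat.zero_add] at a1 a2
      exact core_pair hh hs (show y % h + x % h = h by omega) a2 a1
    have c1 : q + 1 ≤ ((partsM s).toFinset.filter (fun y => y % h = j)).card := by
      have : (Finset.range (q + 1)).image (fun k => k * h + j) ⊆
          (partsM s).toFinset.filter (fun y => y % h = j) := by
        intro y hy
        obtain ⟨k, hk, rfl⟩ := Finset.mem_image.1 hy
        have hk := Finset.mem_range.1 hk
        rw [Finset.mem_filter, Multiset.mem_toFinset]
        refine ⟨desc x hxm hx k (by omega), ?_⟩
        rw [Nat.mul_add_mod_self_right, Nat.mod_eq_of_lt hjlt]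
      have h2 := Finset.card_le_card this
      rw [Finset.card_image_of_injective, Finset.card_range] at h2
      · exact h2
      · intro a b hab
        exact Nat.eq_of_mul_eq_mul_right (show 0 < h by omega) (Nat.add_right_cancel hab)
    rw [e, c2]
    simp
    omega
  · intro hlt
    by_contra hxm
    have c1 : ((partsM s).toFinset.filter (fun y => y % h = j)).card ≤ q := by
      have : (partsM s).toFinset.filter (fun y => y % h = j) ⊆
          (Finset.range q).image (fun k => k * h + j) := by
        intro y hy
        rw [Finset.mem_filter, Multiset.mem_toFinset] at hy
        refine Finset.mem_image.2 ⟨y / h, ?_, by rw [← hy.2, Nat.div_add_mod']⟩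
        rw [Finset.mem_range]
        by_contra h1
        apply hxm
        have := desc y hy.1 (by omega) q (by omega)
        rwa [hy.2, hdiv] at this
      have h2 := Finset.card_le_card this
      have h3 := Finset.card_image_le (s := Finset.range q) (f := fun k => k * h + j)
      rw [Finset.card_range] at h3
      omega
    rw [e] at hlt
    omega

lemma core_unique {h : ℕ} (hh : h % 2 = 1) {s t : BPartition} (hs : IsBarCore h s)
    (ht : IsBarCore h t) (he : ∀ j < h, partSum (g h j) s = partSum (g h j) t) : s = t := by
  apply partsM_inj
  have hh1 : 1 ≤ h := by omega
  rw [Multiset.Nodup.ext (core_nodup hh1 hs) (core_nodup hh1 ht)]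
  intro x
  by_cases hx : x % h = 0
  · exact iff_of_false (fun h1 => core_dvd hh1 hs h1 (Nat.dvd_of_mod_eq_zero hx))
      (fun h1 => core_dvd hh1 ht h1 (Nat.dvd_of_mod_eq_zero hx))
  · rw [core_mem hh hs hx, core_mem hh ht hx, he _ (Nat.mod_lt x (by omega))]

lemma core_exists' {h : ℕ} (hh : 1 ≤ h) {lam : BPartition} (hl : IsHStrict h lam) :
    ∃ w tau, IsBarCore h tau ∧ barChain h w lam tau := by
  have := size_nonneg lam
  exact core_exists hh ((partSum (fun l => (l : ℤ)) lam).toNat + 1) lam hl (by push_cast; omega)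

lemma step_neg {n h i : ℕ} (hn : 1 ≤ n) (hh : h = 2 * n + 1) (hi : i ≤ n) :
    ee n i * ((g h i (i + 1) - g h i i) - (g h (i + 1) (i + 1) - g h (i + 1) i)) = -4 := by
  unfold g ee
  rw [Nat.mod_eq_of_lt (show i + 1 < h by omega), Nat.mod_eq_of_lt (show i < h by omega)]
  split_ifs <;> first | omega | (simp_all; done) | (simp_all <;> omega)

/-- `psi` of a core is a core. -/
lemma psi_core {n h i : ℕ} (hn : 1 ≤ n) (hh : h = 2 * n + 1) (hi : i ≤ n) {s : BPartition}
    (hs : IsBarCore h s) : IsBarCore h (psi h i s) := by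
  have hodd : h % 2 = 1 := by omega
  have hh1 : 1 ≤ h := by omega
  obtain ⟨a1, d, a2, a3, a4⟩ := psi_num hn hh hi hs.1
  obtain ⟨w, t, ht, hc⟩ := core_exists' hh1 a1
  obtain ⟨b1, d', b2, b3, b4⟩ := psi_num hn hh hi ht.1
  obtain ⟨w', s', hs', hc'⟩ := core_exists' hh1 b1
  have hd : d' = -d := by
    rw [← chain_g hc (show i < h by omega), ← chain_g hc (show i + 1 < h by omega),
      a4 i (by omega), a4 (i + 1) (by omega)] at b2
    have := step_neg hn hh hi
    have : 2 * d' = 2 * d + d * (-4) := by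
      rw [b2, a2, ← this]; ring
    linarith
  have hss : s' = s := by
    apply core_unique hodd hs' hs
    intro j hj
    rw [← chain_g hc' hj, b4 j hj, ← chain_g hc hj, a4 j hj, hd]
    ring
  have e1 := chain_size hc
  have e2 := chain_size hc'
  rw [hss] at e2
  have p2 : (0 : ℤ) ≤ h * w' := by positivity
  have hw : (h : ℤ) * w = 0 := by
    have p1 : (0 : ℤ) ≤ h * w := by positivity
    linarith
  have hw0 : w = 0 := by
    rcases mul_eq_zero.1 hw with h1 | h1
    · omega
    · exact_mod_cast h1
  subst hw0
  have : psi h i s = t := hc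
  rw [this]
  exact ht

end BPartition

open BPartition in
/-- If λ has h-bar-core σ and h-bar-weight w, then ψ_i(λ) has h-bar-core ψ_i(σ)
and h-bar-weight w. -/
theorem stmt3 (n h : ℕ) (hn : 1 ≤ n) (hh : h = 2 * n + 1) (i : ℕ) (hi : i ≤ n)
    (σ lam : BPartition) (w : ℕ) (hmem : InBlock h σ w lam) :
    InBlock h (psi h i σ) w (psi h i lam) := by
  obtain ⟨hl, hs, hc⟩ := hmem
  have hodd : h % 2 = 1 := by omega
  have hh1 : 1 ≤ h := by omega
  have hps := psi_core hn hh hi hs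
  obtain ⟨a1, d, a2, a3, a4⟩ := psi_num hn hh hi hl
  obtain ⟨b1, d', b2, b3, b4⟩ := psi_num hn hh hi hs.1
  obtain ⟨w', t, ht, hc'⟩ := core_exists' hh1 a1
  have hd : d' = d := by
    rw [← chain_g hc (show i < h by omega), ← chain_g hc (show i + 1 < h by omega)] at b2
    linarith
  have hts : t = psi h i σ := by
    apply core_unique hodd ht hps
    intro j hj
    rw [← chain_g hc' hj, a4 j hj, b4 j hj, chain_g hc hj, hd]
  subst hts
  have e1 := chain_size hc
  have e2 := chain_size hc'
  have hw : (h : ℤ) * w' = h * w := by linarith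
  have hw' : w' = w := by
    have := mul_left_cancel₀ (show (h : ℤ) ≠ 0 by omega) hw
    exact_mod_cast this
  subst hw'
  exact ⟨a1, hps, hc'⟩
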